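/- arXiv:2309.01058 — 7 statements merged into one kernel-verified Lean document; each statement's English description precedes it below -/
import Mathlib

section
/- Let v : ℝ³ → ℂ be infinitely differentiable with (closed) support contained in the open ball B_R, and set f := −(Δ(Δv) − κ⁴ v). Then f is a nonradiating source: for every x with ‖x‖ > R, ∫_{B_R} G(x,y) f(y) dy = 0, where G(x,y) = −(1/(2κ²)) (e^{iκ‖x−y‖} − e^{−κ‖x−y‖})/(4π‖x−y‖) is the biharmonic wave Green's function. -/
open MeasureTheory Real

noncomputable section

abbrev E3 := EuclideanSpace ℝ (Fin 3)

/-- The open ball of radius `R` centered at the origin. -/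
def ball3 (R : ℝ) : Set E3 := {x : E3 | ‖x‖ < R}

/-- The Laplacian: the sum of the second partial derivatives along coordinate directions. -/
def Lap (w : E3 → ℂ) (x : E3) : ℂ :=
  ∑ i : Fin 3,
    fderiv ℝ (fun z => fderiv ℝ w z (EuclideanSpace.single i (1 : ℝ))) x
      (EuclideanSpace.single i (1 : ℝ))

/-- The Green's function of the biharmonic wave equation in three dimensions. -/
def G3 (κ : ℝ) (x y : E3) : ℂ :=
  -(1 / (2 * (κ : ℂ) ^ 2)) *
    ((Complex.exp (Complex.I * (κ : ℂ) * (‖x - y‖ : ℂ)) -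
        ((Real.exp (-(κ * ‖x - y‖)) : ℝ) : ℂ)) / ((4 * π * ‖x - y‖ : ℝ) : ℂ))

lemma r_deriv (x y : E3) (hxy : y ≠ x) (i : Fin 3) :
    HasDerivAt (fun t : ℝ => ‖x - (y + t • EuclideanSpace.single i (1 : ℝ))‖)
      ((y i - x i) / ‖x - y‖) 0 := by
  have h1 : HasDerivAt (fun t : ℝ => x - (y + t • (EuclideanSpace.single i (1 : ℝ) : E3)))
      (-(EuclideanSpace.single i (1 : ℝ) : E3)) 0 := by
    have := (((hasDerivAt_id (0 : ℝ)).smul_const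
      (EuclideanSpace.single i (1 : ℝ) : E3)).const_add y).const_sub x
    simpa using this
  have hr : ‖x - y‖ ≠ 0 := by
    rw [norm_ne_zero_iff, sub_ne_zero]; exact hxy.symm
  have h2 := h1.norm_sq.sqrt (by simpa using hr)
  simp only [Pi.pow_apply, Real.sqrt_sq (norm_nonneg _)] at h2
  convert h2 using 1
  have : inner ℝ (x - y) (-(EuclideanSpace.single i (1 : ℝ) : E3)) = y i - x i := by
    rw [inner_neg_right, EuclideanSpace.inner_single_right]; simp
  simp only [zero_smul, add_zero, this]
  field_simp

/-- The spherical wave `exp (c r) / r`. -/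
def Ph (c : ℂ) (x y : E3) : ℂ := Complex.exp (c * (‖x - y‖ : ℂ)) / (‖x - y‖ : ℂ)

/-- Its first partial derivatives. -/
def Ph1 (c : ℂ) (x : E3) (i : Fin 3) (y : E3) : ℂ :=
  Complex.exp (c * (‖x - y‖ : ℂ)) * (c * (‖x - y‖ : ℂ) - 1) / (‖x - y‖ : ℂ) ^ 3 *
    ((y i - x i : ℝ) : ℂ)

/-- Its second pure partial derivatives. -/
def Ph2 (c : ℂ) (x : E3) (i : Fin 3) (y : E3) : ℂ :=
  Complex.exp (c * (‖x - y‖ : ℂ)) * ((c * (‖x - y‖ : ℂ) - 1) / (‖x - y‖ : ℂ) ^ 3 +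
    ((y i - x i : ℝ) : ℂ) ^ 2 * (c ^ 2 * (‖x - y‖ : ℂ) ^ 2 - 3 * c * (‖x - y‖ : ℂ) + 3)
      / (‖x - y‖ : ℂ) ^ 5)

lemma r_ne {x y : E3} (hxy : y ≠ x) : (‖x - y‖ : ℂ) ≠ 0 := by
  rw [Complex.ofReal_ne_zero, norm_ne_zero_iff, sub_ne_zero]; exact hxy.symm

lemma Ph_deriv (c : ℂ) (x y : E3) (hxy : y ≠ x) (i : Fin 3) :
    HasLineDerivAt ℝ (Ph c x) (Ph1 c x i y) y (EuclideanSpace.single i (1 : ℝ)) := by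
  have hr := (r_deriv x y hxy i).ofReal_comp
  have h0 := r_ne hxy
  have h := ((hr.const_mul c).cexp).div hr (by simpa using h0)
  unfold HasLineDerivAt Ph Ph1
  refine h.congr_deriv ?_
  simp only [zero_smul, add_zero]
  push_cast
  field_simp

lemma Ph1_deriv (c : ℂ) (x y : E3) (hxy : y ≠ x) (i : Fin 3) :
    HasLineDerivAt ℝ (Ph1 c x i) (Ph2 c x i y) y (EuclideanSpace.single i (1 : ℝ)) := by
  have hr := (r_deriv x y hxy i).ofReal_comp
  have h0 := r_ne hxy
  have hi : HasDerivAt (fun t : ℝ =>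
      (y + t • (EuclideanSpace.single i (1 : ℝ) : E3)) i - x i) 1 0 := by
    have := ((hasDerivAt_id (0 : ℝ)).const_add (y i)).sub_const (x i)
    simpa using this
  have h := ((((hr.const_mul c).cexp).mul ((hr.const_mul c).sub_const 1)).div (hr.pow 3)
    (by simpa using h0)).mul hi.ofReal_comp
  unfold HasLineDerivAt Ph1 Ph2
  refine h.congr_deriv ?_
  simp only [zero_smul, add_zero, Pi.mul_apply, Pi.div_apply, Pi.pow_apply]
  push_cast
  field_simp
  ring

lemma Ph2_sum (c : ℂ) (x y : E3) (hxy : y ≠ x) :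
    ∑ i, Ph2 c x i y = c ^ 2 * Ph c x y := by
  have h0 := r_ne hxy
  have hs : (‖x - y‖ : ℂ) ^ 2 = ∑ i, ((y i - x i : ℝ) : ℂ) ^ 2 := by
    have := EuclideanSpace.real_norm_sq_eq (x - y)
    rw [← Complex.ofReal_pow, this]
    push_cast
    refine Finset.sum_congr rfl fun i _ => ?_
    simp only [PiLp.sub_apply]
    push_cast
    ring
  rw [Fin.sum_univ_three] at hs ⊢
  unfold Ph2 Ph
  generalize Complex.exp (c * (‖x - y‖ : ℂ)) = e at *
  generalize (‖x - y‖ : ℂ) = r at *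
  generalize ((y 0 - x 0 : ℝ) : ℂ) = a at *
  generalize ((y 1 - x 1 : ℝ) : ℂ) = b at *
  generalize ((y 2 - x 2 : ℝ) : ℂ) = d at *
  field_simp
  linear_combination (-e * (c ^ 2 * r ^ 2 - 3 * c * r + 3)) * hs

lemma Ph_cont (c : ℂ) (x : E3) : ContinuousOn (Ph c x) {x}ᶜ := by
  unfold Ph
  refine ContinuousOn.div (by fun_prop) (by fun_prop) fun y hy => r_ne hy

lemma Ph1_cont (c : ℂ) (x : E3) (i : Fin 3) : ContinuousOn (Ph1 c x i) {x}ᶜ := by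
  unfold Ph1
  refine ContinuousOn.mul (ContinuousOn.div (by fun_prop) (by fun_prop)
    fun y hy => pow_ne_zero _ (r_ne hy)) (by fun_prop)

lemma Ph2_cont (c : ℂ) (x : E3) (i : Fin 3) : ContinuousOn (Ph2 c x i) {x}ᶜ := by
  unfold Ph2
  refine ContinuousOn.mul (by fun_prop) (ContinuousOn.add (ContinuousOn.div (by fun_prop)
    (by fun_prop) fun y hy => pow_ne_zero _ (r_ne hy)) (ContinuousOn.div (by fun_prop)
    (by fun_prop) fun y hy => pow_ne_zero _ (r_ne hy)))

lemma int_mul (x : E3) (g w : E3 → ℂ) (hg : ContinuousOn g {x}ᶜ) (hw : Continuous w)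
    (hc : HasCompactSupport w) (hx : x ∉ tsupport w) : Integrable (fun y => g y * w y) := by
  have hs : tsupport (fun y => g y * w y) ⊆ tsupport w := tsupport_mul_subset_right
  refine Continuous.integrable_of_hasCompactSupport ?_ hc.mul_left
  refine ContinuousOn.continuous_of_tsupport_subset (hg.mul hw.continuousOn)
    isOpen_compl_singleton (hs.trans ?_)
  intro y hy h
  rw [Set.mem_singleton_iff] at h
  exact hx (h ▸ hy)

lemma ibp (x : E3) (g g' w : E3 → ℂ) (e : E3) (hg : ContinuousOn g {x}ᶜ)
    (hg' : ContinuousOn g' {x}ᶜ) (hd : ∀ y, y ≠ x → HasLineDerivAt ℝ g (g' y) y e)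
    (hw : ContDiff ℝ (⊤ : ℕ∞) w) (hc : HasCompactSupport w) (hx : x ∉ tsupport w) :
    ∫ y, g y * fderiv ℝ w y e = - ∫ y, g' y * w y := by
  refine integral_bilinear_hasLineDerivAt_right_eq_neg_left_of_integrable
    (B := ContinuousLinearMap.mul ℝ ℂ) (v := e) (f := g) (f' := g') (g := w)
    (g' := fun y => fderiv ℝ w y e) (int_mul x g' w hg' hw.continuous hc hx)
    (int_mul x g _ hg ?_ (hc.fderiv_apply ℝ e) fun h => hx (tsupport_fderiv_apply_subset ℝ e h))
    (int_mul x g w hg hw.continuous hc hx) ?_ ?_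
  · exact (hw.continuous_fderiv (by simp)).clm_apply continuous_const
  · intro y hy
    exact hd y fun h => hx (h ▸ hy)
  · intro y _
    exact ((hw.differentiable (by simp)) y).hasFDerivAt.hasLineDerivAt e

lemma smooth_d (w : E3 → ℂ) (e : E3) (hw : ContDiff ℝ (⊤ : ℕ∞) w) :
    ContDiff ℝ (⊤ : ℕ∞) (fun y => fderiv ℝ w y e) :=
  (hw.fderiv_right (m := (⊤ : ℕ∞)) (by simp)).clm_apply contDiff_const

lemma Lap_smooth (w : E3 → ℂ) (hw : ContDiff ℝ (⊤ : ℕ∞) w) : ContDiff ℝ (⊤ : ℕ∞) (Lap w) := by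
  unfold Lap
  exact ContDiff.sum fun i _ => smooth_d _ _ (smooth_d _ _ hw)

lemma Lap_tsupport (w : E3 → ℂ) : tsupport (Lap w) ⊆ tsupport w := by
  refine closure_minimal ?_ (isClosed_tsupport w)
  intro y hy
  by_contra h
  refine hy (Finset.sum_eq_zero fun i _ => ?_)
  refine image_eq_zero_of_notMem_tsupport
    (f := fun y => fderiv ℝ (fun z => fderiv ℝ w z (EuclideanSpace.single i (1 : ℝ))) y
      (EuclideanSpace.single i (1 : ℝ))) fun h' => h ?_
  exact tsupport_fderiv_apply_subset ℝ _ (tsupport_fderiv_apply_subset ℝ _ h')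

lemma green (c : ℂ) (x : E3) (w : E3 → ℂ) (hw : ContDiff ℝ (⊤ : ℕ∞) w)
    (hc : HasCompactSupport w) (hx : x ∉ tsupport w) :
    ∫ y, Ph c x y * Lap w y = c ^ 2 * ∫ y, Ph c x y * w y := by
  have key : ∀ i : Fin 3, ∫ y, Ph c x y * fderiv ℝ (fun z => fderiv ℝ w z
      (EuclideanSpace.single i (1 : ℝ))) y (EuclideanSpace.single i (1 : ℝ))
      = ∫ y, Ph2 c x i y * w y := by
    intro i
    rw [ibp x (Ph c x) (Ph1 c x i) _ _ (Ph_cont c x) (Ph1_cont c x i)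
      (fun y hy => Ph_deriv c x y hy i) (smooth_d _ _ hw) (hc.fderiv_apply ℝ _)
      (fun h => hx (tsupport_fderiv_apply_subset ℝ _ h)),
      ibp x (Ph1 c x i) (Ph2 c x i) _ _ (Ph1_cont c x i) (Ph2_cont c x i)
      (fun y hy => Ph1_deriv c x y hy i) hw hc hx, neg_neg]
  unfold Lap
  simp only [Finset.mul_sum]
  rw [integral_finsetSum, Finset.sum_congr rfl fun i _ => key i, ← integral_finsetSum,
    ← integral_const_mul]
  · refine integral_congr_ae (Filter.Eventually.of_forall fun y => ?_)
    by_cases hy : y = x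
    · have : w y = 0 := image_eq_zero_of_notMem_tsupport (hy ▸ hx)
      simp [this]
    · simp only
      rw [← Finset.sum_mul, Ph2_sum c x y hy, mul_assoc]
  · intro i _
    exact int_mul x _ w (Ph2_cont c x i) hw.continuous hc hx
  · intro i _
    exact int_mul x _ _ (Ph_cont c x) (smooth_d _ _ (smooth_d _ _ hw)).continuous
      ((hc.fderiv_apply ℝ _).fderiv_apply ℝ _)
      fun h => hx (tsupport_fderiv_apply_subset ℝ _ (tsupport_fderiv_apply_subset ℝ _ h))

lemma green2 (c : ℂ) (x : E3) (v : E3 → ℂ) (hv : ContDiff ℝ (⊤ : ℕ∞) v)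
    (hc : HasCompactSupport v) (hx : x ∉ tsupport v) :
    Integrable (fun y => Ph c x y * (Lap (Lap v) y - c ^ 4 * v y)) ∧
    ∫ y, Ph c x y * (Lap (Lap v) y - c ^ 4 * v y) = 0 := by
  have hx1 : x ∉ tsupport (Lap v) := fun h => hx (Lap_tsupport v h)
  have hc1 : HasCompactSupport (Lap v) :=
    hc.of_isClosed_subset (isClosed_tsupport _) (Lap_tsupport v)
  have hx2 : x ∉ tsupport (Lap (Lap v)) := fun h => hx1 (Lap_tsupport _ h)
  have hc2 : HasCompactSupport (Lap (Lap v)) :=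
    hc1.of_isClosed_subset (isClosed_tsupport _) (Lap_tsupport _)
  have hs := Lap_smooth v hv
  have i1 := int_mul x _ _ (Ph_cont c x) (Lap_smooth _ hs).continuous hc2 hx2
  have i2 := (int_mul x _ _ (Ph_cont c x) hv.continuous hc hx).const_mul (c ^ 4)
  have e : (fun y => Ph c x y * (Lap (Lap v) y - c ^ 4 * v y)) =
      fun y => Ph c x y * Lap (Lap v) y - c ^ 4 * (Ph c x y * v y) := by
    funext y; ring
  rw [e]
  refine ⟨i1.sub i2, ?_⟩
  rw [integral_sub i1 i2, integral_const_mul, green c x _ hs hc1 hx1, green c x v hv hc hx]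
  ring

theorem smooth_compactly_supported_source_is_nonradiating
    (κ R : ℝ) (hκ : 0 < κ) (hR : 0 < R)
    (v : E3 → ℂ) (hv : ContDiff ℝ (⊤ : ℕ∞) v) (hsupp : tsupport v ⊆ ball3 R)
    (f : E3 → ℂ) (hf : ∀ x : E3, f x = -(Lap (Lap v) x - (κ : ℂ) ^ 4 * v x)) :
    ∀ x : E3, R < ‖x‖ → (∫ y in ball3 R, G3 κ x y * f y) = 0 := by
  intro x hx
  have hxs : x ∉ tsupport v := fun h => absurd (hsupp h) (by simp [ball3, hx.le])
  have hc : HasCompactSupport v := by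
    refine (isCompact_closedBall (0 : E3) R).of_isClosed_subset (isClosed_tsupport v) ?_
    intro y hy
    have : ‖y‖ < R := hsupp hy
    simpa using this.le
  rw [setIntegral_eq_integral_of_forall_compl_eq_zero]
  · obtain ⟨a1, b1⟩ := green2 (Complex.I * κ) x v hv hc hxs
    obtain ⟨a2, b2⟩ := green2 (-κ) x v hv hc hxs
    have c1 : (Complex.I * κ) ^ 4 = (κ : ℂ) ^ 4 := by
      rw [mul_pow, Complex.I_pow_four, one_mul]
    have c2 : (-κ : ℂ) ^ 4 = (κ : ℂ) ^ 4 := by ring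
    rw [c1] at a1 b1
    rw [c2] at a2 b2
    have e : (fun y => G3 κ x y * f y) = fun y => (1 / (2 * (κ : ℂ) ^ 2) / (4 * π)) *
        (Ph (Complex.I * κ) x y * (Lap (Lap v) y - (κ : ℂ) ^ 4 * v y) -
          Ph (-κ) x y * (Lap (Lap v) y - (κ : ℂ) ^ 4 * v y)) := by
      funext y
      rw [hf]
      unfold G3 Ph
      push_cast
      rw [neg_mul (κ : ℂ)]
      simp only [div_eq_mul_inv, mul_inv]
      ring
    rw [e, integral_const_mul, integral_sub a1 a2, b1, b2]
    simp
  · intro y hy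
    have h1 : y ∉ tsupport v := fun h => hy (hsupp h)
    have h2 : y ∉ tsupport (Lap (Lap v)) := fun h => h1 (Lap_tsupport v (Lap_tsupport _ h))
    rw [hf, image_eq_zero_of_notMem_tsupport h1, image_eq_zero_of_notMem_tsupport h2]
    simp
end
end

section
/- Let w : ℝ³ → ℂ be infinitely differentiable with (closed) support contained in the open ball B_R. Then for every x with ‖x‖ > R, the Helmholtz potential of (Δ + κ²)w vanishes: ∫_{B_R} (e^{iκ‖x−y‖}/(4π‖x−y‖)) ((Δw)(y) + κ² w(y)) dy = 0. -/
open MeasureTheory Real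

noncomputable section

def Gf (κ : ℝ) (s : ℝ) : ℂ := Complex.exp (Complex.I * (κ : ℂ) * (s : ℂ)) / (s : ℂ)

def Pf (κ : ℝ) (s : ℝ) : ℂ :=
  Complex.exp (Complex.I * (κ : ℂ) * (s : ℂ)) * (Complex.I * κ * s - 1) / (s : ℂ) ^ 3

theorem hasDerivAt_expk (κ s : ℝ) :
    HasDerivAt (fun s : ℝ => Complex.exp (Complex.I * (κ : ℂ) * (s : ℂ)))
      (Complex.exp (Complex.I * (κ : ℂ) * (s : ℂ)) * (Complex.I * κ)) s := by
  have h1 : HasDerivAt (fun s : ℝ => (s : ℂ)) 1 s := Complex.ofRealCLM.hasDerivAt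
  simpa using (h1.const_mul (Complex.I * (κ : ℂ))).cexp

theorem hasDerivAt_Gf (κ s : ℝ) (hs : s ≠ 0) : HasDerivAt (Gf κ) (s * Pf κ s) s := by
  have h1 : HasDerivAt (fun s : ℝ => (s : ℂ)) 1 s := Complex.ofRealCLM.hasDerivAt
  have hs' : (s : ℂ) ≠ 0 := by exact_mod_cast hs
  refine ((hasDerivAt_expk κ s).div h1 hs').congr_deriv ?_
  unfold Pf
  field_simp

theorem hasDerivAt_Pf (κ s : ℝ) (hs : s ≠ 0) :
    HasDerivAt (Pf κ) ((-3 * Pf κ s - (κ : ℂ) ^ 2 * Gf κ s) / s) s := by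
  have h1 : HasDerivAt (fun s : ℝ => (s : ℂ)) 1 s := Complex.ofRealCLM.hasDerivAt
  have hs' : (s : ℂ) ≠ 0 := by exact_mod_cast hs
  have h2 := ((hasDerivAt_expk κ s).mul ((h1.const_mul (Complex.I * (κ : ℂ))).sub_const 1)).div
    (h1.pow 3) (pow_ne_zero 3 hs')
  refine h2.congr_deriv ?_
  unfold Pf Gf
  simp only [Pi.mul_apply, Pi.pow_apply]
  field_simp
  ring_nf
  simp only [Complex.I_sq]
  ring

theorem contDiffAt_Gf (κ s : ℝ) (hs : s ≠ 0) : ContDiffAt ℝ 1 (Gf κ) s := by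
  have hs' : (s : ℂ) ≠ 0 := by exact_mod_cast hs
  have h1 : ContDiffAt ℝ 1 (fun s : ℝ => (s : ℂ)) s := Complex.ofRealCLM.contDiff.contDiffAt
  unfold Gf
  simp only [div_eq_mul_inv]
  exact (contDiffAt_const.mul h1).cexp.mul (h1.inv hs')

theorem contDiffAt_Pf (κ s : ℝ) (hs : s ≠ 0) : ContDiffAt ℝ 1 (Pf κ) s := by
  have hs' : (s : ℂ) ≠ 0 := by exact_mod_cast hs
  have h1 : ContDiffAt ℝ 1 (fun s : ℝ => (s : ℂ)) s := Complex.ofRealCLM.contDiff.contDiffAt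
  unfold Pf
  simp only [div_eq_mul_inv]
  exact ((contDiffAt_const.mul h1).cexp.mul ((contDiffAt_const.mul h1).sub contDiffAt_const)).mul
    ((h1.pow 3).inv (pow_ne_zero 3 hs'))

abbrev bas (i : Fin 3) : E3 := EuclideanSpace.single i (1 : ℝ)

theorem contDiffAt_r (x y : E3) (h : x ≠ y) : ContDiffAt ℝ 1 (fun y => ‖x - y‖) y :=
  (contDiffAt_const.sub contDiffAt_id).norm ℝ (sub_ne_zero.2 h)

theorem hasLineDerivAt_r (x y : E3) (h : x ≠ y) (i : Fin 3) :
    HasDerivAt (fun t : ℝ => ‖x - (y + t • bas i)‖) ((y i - x i) / ‖x - y‖) 0 := by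
  have hn : ‖x - y‖ ≠ 0 := norm_ne_zero_iff.2 (sub_ne_zero.2 h)
  have h0 : HasDerivAt (fun t : ℝ => x - (y + t • bas i)) (-(bas i)) 0 := by
    have := (((hasDerivAt_id (0 : ℝ)).smul_const (bas i)).const_add y).const_sub x
    simpa using this
  have h1 := h0.norm_sq.sqrt (by simpa using hn)
  have h2 : (fun t : ℝ => √(‖x - (y + t • bas i)‖ ^ 2)) = fun t : ℝ => ‖x - (y + t • bas i)‖ := by
    funext t; exact Real.sqrt_sq (norm_nonneg _)
  rw [h2] at h1
  refine h1.congr_deriv ?_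
  simp only [zero_smul, add_zero, Real.sqrt_sq (norm_nonneg _), inner_neg_right]
  have : inner ℝ (x - y) (bas i) = x i - y i := by
    simp [bas, EuclideanSpace.inner_single_right]
  rw [this]
  field_simp
  ring

def Vf (κ : ℝ) (x : E3) (w : E3 → ℂ) (i : Fin 3) (y : E3) : ℂ :=
  Gf κ ‖x - y‖ * fderiv ℝ w y (bas i) - Pf κ ‖x - y‖ * ((y i - x i : ℝ) : ℂ) * w y

theorem contDiff_dw (w : E3 → ℂ) (hw : ContDiff ℝ (⊤ : ℕ∞) w) (i : Fin 3) :
    ContDiff ℝ 1 (fun z => fderiv ℝ w z (bas i)) :=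
  (hw.fderiv_right (m := 1) (by norm_cast)).clm_apply contDiff_const

theorem contDiffAt_Vf (κ : ℝ) (x : E3) (w : E3 → ℂ) (hw : ContDiff ℝ (⊤ : ℕ∞) w) (i : Fin 3)
    (y : E3) (h : x ≠ y) : ContDiffAt ℝ 1 (Vf κ x w i) y := by
  have hn : ‖x - y‖ ≠ 0 := norm_ne_zero_iff.2 (sub_ne_zero.2 h)
  have hG : ContDiffAt ℝ 1 (fun y => Gf κ ‖x - y‖) y :=
    ContDiffAt.comp y (contDiffAt_Gf κ _ hn) (contDiffAt_r x y h)
  have hP : ContDiffAt ℝ 1 (fun y => Pf κ ‖x - y‖) y :=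
    ContDiffAt.comp y (contDiffAt_Pf κ _ hn) (contDiffAt_r x y h)
  have hc : ContDiff ℝ 1 (fun y : E3 => ((y i - x i : ℝ) : ℂ)) :=
    Complex.ofRealCLM.contDiff.comp
      (((EuclideanSpace.proj (𝕜 := ℝ) i : E3 →L[ℝ] ℝ).contDiff).sub contDiff_const)
  have hw1 : ContDiff ℝ 1 w := hw.of_le (by norm_cast)
  exact (hG.mul (contDiff_dw w hw i).contDiffAt).sub ((hP.mul hc.contDiffAt).mul hw1.contDiffAt)

theorem hasLine_of_diff (f : E3 → ℂ) (y v : E3) (hf : DifferentiableAt ℝ f y) :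
    HasDerivAt (fun t : ℝ => f (y + t • v)) (fderiv ℝ f y v) 0 :=
  hf.hasFDerivAt.hasLineDerivAt v

theorem fderiv_Vf (κ : ℝ) (x : E3) (w : E3 → ℂ) (hw : ContDiff ℝ (⊤ : ℕ∞) w) (i : Fin 3)
    (y : E3) (h : x ≠ y) :
    fderiv ℝ (Vf κ x w i) y (bas i) =
      Gf κ ‖x - y‖ * fderiv ℝ (fun z => fderiv ℝ w z (bas i)) y (bas i)
      - (((y i - x i : ℝ) : ℂ) ^ 2 * (-3 * Pf κ ‖x - y‖ - (κ : ℂ) ^ 2 * Gf κ ‖x - y‖)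
          / (‖x - y‖ : ℂ) ^ 2 + Pf κ ‖x - y‖) * w y := by
  have hn : ‖x - y‖ ≠ 0 := norm_ne_zero_iff.2 (sub_ne_zero.2 h)
  have hn' : (‖x - y‖ : ℂ) ≠ 0 := by exact_mod_cast hn
  have hV := hasLine_of_diff _ y (bas i) ((contDiffAt_Vf κ x w hw i y h).differentiableAt one_ne_zero)
  have hr := hasLineDerivAt_r x y h i
  have hG := HasDerivAt.scomp_of_eq (0 : ℝ) (hasDerivAt_Gf κ _ hn) hr (by simp)
  have hP := HasDerivAt.scomp_of_eq (0 : ℝ) (hasDerivAt_Pf κ _ hn) hr (by simp)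
  have hdw := hasLine_of_diff _ y (bas i) ((contDiff_dw w hw i).differentiable one_ne_zero y)
  have hw1 := hasLine_of_diff w y (bas i) (hw.differentiable (by simp) y)
  have hc : HasDerivAt (fun t : ℝ => (((y + t • bas i) i - x i : ℝ) : ℂ)) 1 0 := by
    have : HasDerivAt (fun t : ℝ => ((y + t • bas i) i - x i : ℝ)) 1 0 := by
      have := ((hasDerivAt_id (0 : ℝ)).const_add (y i)).sub_const (x i)
      simpa [bas] using this
    simpa using this.ofReal_comp
  have hall := (hG.mul hdw).sub ((hP.mul hc).mul hw1)
  refine (hV.unique hall).trans ?_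
  simp only [Function.comp_apply, Pi.mul_apply, zero_smul, add_zero, Complex.real_smul,
    Complex.ofReal_div]
  field_simp
  ring

theorem div_Vf (κ : ℝ) (x : E3) (w : E3 → ℂ) (hw : ContDiff ℝ (⊤ : ℕ∞) w)
    (y : E3) (h : x ≠ y) :
    ∑ i, fderiv ℝ (Vf κ x w i) y (bas i) =
      Gf κ ‖x - y‖ * (Lap w y + (κ : ℂ) ^ 2 * w y) := by
  have hn : ‖x - y‖ ≠ 0 := norm_ne_zero_iff.2 (sub_ne_zero.2 h)
  have hn' : (‖x - y‖ : ℂ) ≠ 0 := by exact_mod_cast hn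
  have hsq : (‖x - y‖ : ℂ) ^ 2 = ∑ i, ((y i - x i : ℝ) : ℂ) ^ 2 := by
    have : ‖x - y‖ ^ 2 = ∑ i, (y i - x i) ^ 2 := by
      rw [norm_sub_rev, EuclideanSpace.norm_sq_eq]
      simp
    exact_mod_cast this
  simp only [fderiv_Vf κ x w hw _ y h, Lap]
  simp only [Fin.sum_univ_three] at hsq ⊢
  have hs2 : (‖x - y‖ : ℂ) ^ 2 ≠ 0 := pow_ne_zero 2 hn'
  generalize hq : (‖x - y‖ : ℂ) ^ 2 = q at *
  generalize Gf κ ‖x - y‖ = g at *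
  generalize Pf κ ‖x - y‖ = p at *
  field_simp
  rw [hsq]
  ring

theorem Vf_zero (κ : ℝ) (x : E3) (w : E3 → ℂ) (i : Fin 3) (y : E3) (hy : y ∉ tsupport w) :
    Vf κ x w i y = 0 := by
  have h1 : w y = 0 := image_eq_zero_of_notMem_tsupport hy
  have h2 : fderiv ℝ w y = 0 :=
    image_eq_zero_of_notMem_tsupport (fun h => hy (tsupport_fderiv_subset ℝ h))
  simp [Vf, h1, h2]

theorem Lap_zero (w : E3 → ℂ) (y : E3) (hy : y ∉ tsupport w) : Lap w y = 0 := by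
  unfold Lap
  refine Finset.sum_eq_zero fun i _ => ?_
  have : (fun z => fderiv ℝ w z (bas i)) =ᶠ[nhds y] fun _ => 0 := by
    filter_upwards [(isClosed_tsupport w).isOpen_compl.mem_nhds hy] with z hz
    have h2 : fderiv ℝ w z = 0 :=
      image_eq_zero_of_notMem_tsupport (fun h => hz (tsupport_fderiv_subset ℝ h))
    simp [h2]
  rw [this.fderiv_eq]
  simp

theorem Vf_eventually (κ : ℝ) (x : E3) (w : E3 → ℂ) (i : Fin 3) (y : E3) (hy : y ∉ tsupport w) :
    Vf κ x w i =ᶠ[nhds y] fun _ => 0 := by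
  filter_upwards [(isClosed_tsupport w).isOpen_compl.mem_nhds hy] with z hz
  exact Vf_zero κ x w i z hz

theorem integral_fderiv_zero (f : E3 → ℂ) (hf : ContDiff ℝ 1 f) (hc : HasCompactSupport f)
    (v : E3) : Integrable (fun y => fderiv ℝ f y v) ∧ ∫ y, fderiv ℝ f y v = 0 := by
  have hi : Integrable (fun y => fderiv ℝ f y v) :=
    ((hf.continuous_fderiv one_ne_zero).clm_apply continuous_const).integrable_of_hasCompactSupport
      (hc.fderiv_apply ℝ v)
  refine ⟨hi, ?_⟩
  have := integral_smul_fderiv_eq_neg_fderiv_smul_of_integrable (μ := (volume : Measure E3))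
    (f := fun _ : E3 => (1 : ℝ)) (g := f) (v := v) (𝕜 := ℝ) (by simp) (by simpa using hi)
    (by simpa using hf.continuous.integrable_of_hasCompactSupport hc)
    (fun _ _ => differentiableAt_const _) (fun y _ => hf.differentiable one_ne_zero y)
  simpa using this

theorem helmholtz_potential_of_helmholtz_operator_vanishes
    (κ R : ℝ) (hκ : 0 < κ) (hR : 0 < R)
    (w : E3 → ℂ) (hw : ContDiff ℝ (⊤ : ℕ∞) w) (hsupp : tsupport w ⊆ ball3 R) :
    ∀ x : E3, R < ‖x‖ →
      (∫ y in ball3 R,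
        (Complex.exp (Complex.I * (κ : ℂ) * (‖x - y‖ : ℂ)) / ((4 * π * ‖x - y‖ : ℝ) : ℂ)) *
          (Lap w y + (κ : ℂ) ^ 2 * w y)) = 0 := by
  intro x hx
  have hxs : x ∉ tsupport w := fun h => by
    have : ‖x‖ < R := hsupp h
    linarith
  have hcw : IsCompact (tsupport w) := by
    refine (isCompact_closedBall (0 : E3) R).of_isClosed_subset (isClosed_tsupport w) ?_
    intro y hy
    have : ‖y‖ < R := hsupp hy
    simpa using this.le
  have hVc : ∀ i, HasCompactSupport (Vf κ x w i) := fun i =>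
    HasCompactSupport.intro hcw (fun y hy => Vf_zero κ x w i y hy)
  have hVd : ∀ i, ContDiff ℝ 1 (Vf κ x w i) := fun i => by
    rw [contDiff_iff_contDiffAt]
    intro y
    by_cases h : x = y
    · subst h
      exact contDiffAt_const.congr_of_eventuallyEq (Vf_eventually κ x w i x hxs)
    · exact contDiffAt_Vf κ x w hw i y h
  rw [setIntegral_eq_integral_of_forall_compl_eq_zero]
  · have key : ∀ y, (Complex.exp (Complex.I * (κ : ℂ) * (‖x - y‖ : ℂ)) /
        ((4 * π * ‖x - y‖ : ℝ) : ℂ)) * (Lap w y + (κ : ℂ) ^ 2 * w y) =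
        (4 * π : ℂ)⁻¹ * ∑ i, fderiv ℝ (Vf κ x w i) y (bas i) := by
      intro y
      by_cases h : x = y
      · subst h
        have h1 : w x = 0 := image_eq_zero_of_notMem_tsupport hxs
        simp [Lap_zero w x hxs, h1, (Vf_eventually κ x w _ x hxs).fderiv_eq]
      · rw [div_Vf κ x w hw y h, Gf]
        push_cast
        simp only [div_eq_mul_inv, mul_inv]
        ring
    simp only [key]
    rw [integral_const_mul, integral_finsetSum _
      (fun i _ => (integral_fderiv_zero _ (hVd i) (hVc i) (bas i)).1)]
    simp [fun i => (integral_fderiv_zero _ (hVd i) (hVc i) (bas i)).2]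
  · intro y hy
    have hy' : y ∉ tsupport w := fun h => hy (hsupp h)
    have h1 : w y = 0 := image_eq_zero_of_notMem_tsupport hy'
    simp [Lap_zero w y hy', h1]
end
end

section
/- For every x ∈ ℝ³ with ‖x‖ > R, the Helmholtz potential of a radial density is given by the one-dimensional integral: ∫_{B_R} (e^{iκ‖x−y‖}/(4π‖x−y‖)) ρ(‖y‖) dy = (e^{iκ‖x‖}/(κ‖x‖)) ∫_0^R ρ(r) sin(κr) r dr. -/
open MeasureTheory Real

noncomputable section

lemma polar_lint (Φ : ℝ × ℝ → ENNReal) (hΦ : Measurable Φ) :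
    ∫⁻ y : E3, Φ (‖y‖, y 0) = ∫⁻ p in polarCoord.target,
      ENNReal.ofReal (2 * π * p.1 * (p.1 * sin p.2)) * Φ (p.1, p.1 * cos p.2) := by
  have e1 : ∫⁻ y : E3, Φ (‖y‖, y 0) =
      ∫⁻ v : Fin 3 → ℝ, Φ (√ (v 0 ^ 2 + (v 1 ^ 2 + v 2 ^ 2)), v 0) := by
    rw [← (EuclideanSpace.volume_preserving_symm_measurableEquiv_toLp (Fin 3)).symm.lintegral_comp_emb
      (MeasurableEquiv.measurableEmbedding _)]
    refine lintegral_congr fun v => ?_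
    simp [EuclideanSpace.norm_eq, Fin.sum_univ_three, add_assoc]
  have e2 : ∫⁻ v : Fin 3 → ℝ, Φ (√ (v 0 ^ 2 + (v 1 ^ 2 + v 2 ^ 2)), v 0) =
      ∫⁻ q : ℝ × (Fin 2 → ℝ), Φ (√ (q.1 ^ 2 + (q.2 0 ^ 2 + q.2 1 ^ 2)), q.1) := by
    rw [← (volume_preserving_piFinSuccAbove (fun _ : Fin 3 => ℝ) 0).lintegral_comp_emb
      (MeasurableEquiv.measurableEmbedding _)]
    rfl
  have e3 : ∀ a : ℝ, ∫⁻ w : Fin 2 → ℝ, Φ (√ (a ^ 2 + (w 0 ^ 2 + w 1 ^ 2)), a) =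
      ENNReal.ofReal (2 * π) * ∫⁻ s : ℝ, ENNReal.ofReal s * Φ (√ (a ^ 2 + s ^ 2), a) := by
    intro a
    have : ∫⁻ w : Fin 2 → ℝ, Φ (√ (a ^ 2 + (w 0 ^ 2 + w 1 ^ 2)), a) =
        ∫⁻ w : ℝ × ℝ, Φ (√ (a ^ 2 + (w.1 ^ 2 + w.2 ^ 2)), a) := by
      rw [← (volume_preserving_finTwoArrow ℝ).lintegral_comp_emb
        (MeasurableEquiv.measurableEmbedding _)]
      rfl
    rw [this, ← lintegral_comp_polarCoord_symm]
    have : ∀ p : ℝ × ℝ, ENNReal.ofReal p.1 • Φ (√ (a ^ 2 + ((polarCoord.symm p).1 ^ 2 +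
        (polarCoord.symm p).2 ^ 2)), a) = 
        (ENNReal.ofReal p.1 * Φ (√ (a ^ 2 + p.1 ^ 2), a)) * 1 := by
      intro p
      have : (p.1 * cos p.2) ^ 2 + (p.1 * sin p.2) ^ 2 = p.1 ^ 2 := by
        rw [mul_pow, mul_pow, ← mul_add, cos_sq_add_sin_sq, mul_one]
      simp [polarCoord_symm_apply, this]
    simp_rw [this]
    rw [polarCoord_target, Measure.volume_eq_prod, ← Measure.prod_restrict, 
      lintegral_prod_mul (f := fun r => ENNReal.ofReal r * Φ (√ (a ^ 2 + r ^ 2), a)) (g := fun _ => 1)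
        (by fun_prop) (by fun_prop)]
    rw [mul_comm]
    congr 1
    · rw [lintegral_one, Measure.restrict_apply_univ, Real.volume_Ioo]
      ring_nf
    · rw [← lintegral_indicator measurableSet_Ioi]
      refine lintegral_congr fun r => ?_
      by_cases h : 0 < r
      · simp [h]
      · simp [h, ENNReal.ofReal_of_nonpos (not_lt.1 h)]
  rw [e1, e2, Measure.volume_eq_prod, lintegral_prod _ (by fun_prop)]
  simp_rw [e3]
  rw [lintegral_const_mul _ (by fun_prop), 
    ← lintegral_prod (f := fun p : ℝ × ℝ => ENNReal.ofReal p.2 * Φ (√ (p.1 ^ 2 + p.2 ^ 2), p.1)) (by fun_prop),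
    ← Measure.volume_eq_prod, ← lintegral_comp_polarCoord_symm,
    ← lintegral_const_mul _ (by simp only [polarCoord_symm_apply]; fun_prop)]
  refine setLIntegral_congr_fun polarCoord.open_target.measurableSet fun p hp => ?_
  have hp0 : 0 < p.1 := by simpa using hp.1
  have : (p.1 * cos p.2) ^ 2 + (p.1 * sin p.2) ^ 2 = p.1 ^ 2 := by
    rw [mul_pow, mul_pow, ← mul_add, cos_sq_add_sin_sq, mul_one]
  simp only [polarCoord_symm_apply, this, sqrt_sq hp0.le, smul_eq_mul]
  rw [ENNReal.ofReal_mul (p := 2 * π * p.1) (by positivity),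
    ENNReal.ofReal_mul (p := 2 * π) (by positivity)]
  ring

lemma polar_map : Measure.map (fun y : E3 => (‖y‖, y 0)) volume =
    Measure.map (fun p : ℝ × ℝ => (p.1, p.1 * cos p.2))
      ((volume.restrict polarCoord.target).withDensity
        fun p => ENNReal.ofReal (2 * π * p.1 * (p.1 * sin p.2))) := by
  refine Measure.ext_of_lintegral _ fun Φ hΦ => ?_
  rw [lintegral_map hΦ (by fun_prop), lintegral_map hΦ (by fun_prop), polar_lint Φ hΦ,
    lintegral_withDensity_eq_lintegral_mul _ (by fun_prop) (by fun_prop)]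
  rfl

lemma polar_integral (K : ℝ × ℝ → ℂ) (hK : Measurable K) :
    ∫ y : E3, K (‖y‖, y 0) = ∫ p in polarCoord.target,
      (max (2 * π * p.1 * (p.1 * sin p.2)) 0) • K (p.1, p.1 * cos p.2) := by
  rw [← integral_map (φ := fun y : E3 => (‖y‖, y 0)) (f := K) (by fun_prop)
    hK.aestronglyMeasurable, polar_map, integral_map (by fun_prop) hK.aestronglyMeasurable,
    integral_withDensity_eq_integral_toReal_smul (by fun_prop) (by simp)]
  rfl

lemma polar_integral' (K : ℝ × ℝ → ℂ) (hK : Measurable K) (e : E3) (he : ‖e‖ = 1) :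
    ∫ y : E3, K (‖y‖, inner ℝ e y) = ∫ p in polarCoord.target,
      (max (2 * π * p.1 * (p.1 * sin p.2)) 0) • K (p.1, p.1 * cos p.2) := by
  rw [← polar_integral K hK]
  set f : E3 := EuclideanSpace.single 0 1
  have hf : ‖f‖ = 1 := by simp [f]
  have hr := Submodule.reflection_sub (he.trans hf.symm)
  set T := (Submodule.span ℝ {e - f})ᗮ.reflection
  rw [← T.measurePreserving.integral_comp T.toMeasurableEquiv.measurableEmbedding
    (fun y => K (‖y‖, y 0))]
  congr 1
  ext y
  have : (T y) 0 = inner ℝ e y := by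
    rw [← T.inner_map_map e y, hr]
    simp [f, PiLp.inner_apply, Fin.sum_univ_three]
  simp [this]

lemma u_bound (d r c : ℝ) (hr : 0 ≤ r) (hd : r < d) (hc : c ≤ 1) :
    d - r ≤ √ (d ^ 2 + r ^ 2 - 2 * d * (r * c)) := by
  apply Real.le_sqrt_of_sq_le
  nlinarith [mul_nonneg (mul_nonneg hr (hr.trans hd.le)) (sub_nonneg.2 hc)]

lemma inner_theta (κ d r : ℝ) (hκ : 0 < κ) (hr : 0 < r) (hd : r < d) :
    ∫ θ in (0 : ℝ)..π, (sin θ : ℂ) *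
      (Complex.exp (Complex.I * κ * (√ (d ^ 2 + r ^ 2 - 2 * d * (r * cos θ)) : ℝ)) /
        ((4 * π * √ (d ^ 2 + r ^ 2 - 2 * d * (r * cos θ)) : ℝ) : ℂ)) =
      Complex.exp (Complex.I * κ * d) * (sin (κ * r) : ℝ) / ((2 * π * κ * d * r : ℝ) : ℂ) := by
  have hd0 : 0 < d := hr.trans hd
  have hup : ∀ θ, 0 < √ (d ^ 2 + r ^ 2 - 2 * d * (r * cos θ)) := fun θ =>
    lt_of_lt_of_le (sub_pos.2 hd) (u_bound d r _ hr.le hd (cos_le_one θ))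
  have hcd : (d : ℂ) ≠ 0 := by exact_mod_cast hd0.ne'
  have hcr : (r : ℂ) ≠ 0 := by exact_mod_cast hr.ne'
  have hcκ : (κ : ℂ) ≠ 0 := by exact_mod_cast hκ.ne'
  have hcπ : (π : ℂ) ≠ 0 := by exact_mod_cast pi_ne_zero
  have key : ∀ θ : ℝ, HasDerivAt (fun θ : ℝ =>
      Complex.exp (Complex.I * κ * (√ (d ^ 2 + r ^ 2 - 2 * d * (r * cos θ)) : ℝ)) /
        (4 * π * Complex.I * κ * d * r : ℂ))
      ((sin θ : ℂ) *
      (Complex.exp (Complex.I * κ * (√ (d ^ 2 + r ^ 2 - 2 * d * (r * cos θ)) : ℝ)) /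
        ((4 * π * √ (d ^ 2 + r ^ 2 - 2 * d * (r * cos θ)) : ℝ) : ℂ))) θ := by
    intro θ
    have h1 : HasDerivAt (fun θ : ℝ => d ^ 2 + r ^ 2 - 2 * d * (r * cos θ))
        (2 * d * (r * sin θ)) θ := by
      have := (((hasDerivAt_cos θ).const_mul r).const_mul (2 * d)).const_sub (d ^ 2 + r ^ 2)
      exact this.congr_deriv (by ring)
    have h2 := (h1.sqrt (Real.sqrt_pos.1 (hup θ)).ne').ofReal_comp
    have h3 := ((h2.const_mul (Complex.I * κ)).cexp).div_const (4 * π * Complex.I * κ * d * r : ℂ)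
    refine h3.congr_deriv ?_
    have hcu : ((√ (d ^ 2 + r ^ 2 - 2 * d * (r * cos θ)) : ℝ) : ℂ) ≠ 0 := by
      exact_mod_cast (hup θ).ne'
    generalize √ (d ^ 2 + r ^ 2 - 2 * d * (r * cos θ)) = u at hcu
    push_cast
    field_simp [Complex.I_ne_zero]
    try ring
  rw [intervalIntegral.integral_eq_sub_of_hasDerivAt (fun θ _ => key θ)]
  · have a1 : √ (d ^ 2 + r ^ 2 - 2 * d * (r * cos π)) = d + r := by
      rw [cos_pi, ← Real.sqrt_sq (by positivity : 0 ≤ d + r)]; congr 1; ring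
    have a2 : √ (d ^ 2 + r ^ 2 - 2 * d * (r * cos 0)) = d - r := by
      rw [cos_zero, ← Real.sqrt_sq (by linarith : 0 ≤ d - r)]; congr 1; ring
    rw [a1, a2, Complex.ofReal_sin, Complex.sin]
    have b1 : Complex.I * κ * ((d + r : ℝ) : ℂ) = Complex.I * κ * d + Complex.I * κ * r := by
      push_cast; ring
    have b2 : Complex.I * κ * ((d - r : ℝ) : ℂ) = Complex.I * κ * d + -(Complex.I * κ * r) := by
      push_cast; ring
    have b3 : ((κ * r : ℝ) : ℂ) * Complex.I = Complex.I * κ * r := by push_cast; ring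
    rw [b1, b2, Complex.exp_add, Complex.exp_add, neg_mul, b3]
    push_cast
    generalize Complex.exp (Complex.I * κ * d) = A
    generalize Complex.exp (Complex.I * κ * r) = B
    generalize Complex.exp (-(Complex.I * κ * r)) = C
    field_simp
    linear_combination (4 * A * (B - C)) * Complex.I_sq
  · apply Continuous.intervalIntegrable
    refine Continuous.mul (by fun_prop) (Continuous.div (by fun_prop) (by fun_prop) ?_)
    intro θ
    have := hup θ
    exact_mod_cast (by positivity : 4 * π * √ (d ^ 2 + r ^ 2 - 2 * d * (r * cos θ)) ≠ 0)

theorem helmholtz_potential_radial_density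
    (κ R : ℝ) (hκ : 0 < κ) (hR : 0 < R)
    (ρ : ℝ → ℂ) (hρ_meas : Measurable ρ)
    (hρ_int : IntegrableOn (fun r : ℝ => ρ r * (r : ℂ) ^ 2) (Set.Icc 0 R)) :
    ∀ x : E3, R < ‖x‖ →
      (∫ y in ball3 R,
        (Complex.exp (Complex.I * (κ : ℂ) * (‖x - y‖ : ℂ)) / ((4 * π * ‖x - y‖ : ℝ) : ℂ)) *
          ρ ‖y‖) =
      (Complex.exp (Complex.I * (κ : ℂ) * (‖x‖ : ℂ)) / ((κ * ‖x‖ : ℝ) : ℂ)) *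
        ∫ r in (0 : ℝ)..R, ρ r * ((Real.sin (κ * r) : ℝ) : ℂ) * (r : ℂ) := by
  intro x hx
  obtain ⟨d, hd⟩ : ∃ d, d = ‖x‖ := ⟨_, rfl⟩
  rw [← hd] at hx ⊢
  have hd0 : 0 < d := hR.trans hx
  obtain ⟨K, hKdef⟩ : ∃ K : ℝ × ℝ → ℂ, K = fun q => Set.indicator (Set.Iio R)
      (fun _ => (Complex.exp (Complex.I * (κ : ℂ) *
        (√ (d ^ 2 + q.1 ^ 2 - 2 * d * q.2) : ℝ)) /
        ((4 * π * √ (d ^ 2 + q.1 ^ 2 - 2 * d * q.2) : ℝ) : ℂ)) * ρ q.1) q.1 := ⟨_, rfl⟩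
  have hK : Measurable K := by
    rw [hKdef]
    have : MeasurableSet {q : ℝ × ℝ | q.1 < R} := measurableSet_lt (by fun_prop) (by fun_prop)
    exact Measurable.indicator (s := {q : ℝ × ℝ | q.1 < R}) (f := fun q : ℝ × ℝ =>
      (Complex.exp (Complex.I * (κ : ℂ) *
        (√ (d ^ 2 + q.1 ^ 2 - 2 * d * q.2) : ℝ)) /
        ((4 * π * √ (d ^ 2 + q.1 ^ 2 - 2 * d * q.2) : ℝ) : ℂ)) * ρ q.1) (by fun_prop) this
  have hball : MeasurableSet (ball3 R) := measurableSet_lt (by fun_prop) (by fun_prop)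
  have s1 : (∫ y in ball3 R,
        (Complex.exp (Complex.I * (κ : ℂ) * (‖x - y‖ : ℂ)) / ((4 * π * ‖x - y‖ : ℝ) : ℂ)) *
          ρ ‖y‖) = ∫ y : E3, K (‖y‖, inner ℝ (d⁻¹ • x) y) := by
    rw [← integral_indicator hball]
    congr 1
    ext y
    have hn : ‖x - y‖ = √ (d ^ 2 + ‖y‖ ^ 2 - 2 * d * inner ℝ (d⁻¹ • x) y) := by
      rw [← Real.sqrt_sq (norm_nonneg (x - y)), norm_sub_sq_real, ← hd, real_inner_smul_left]
      congr 1
      field_simp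
      ring
    simp only [hKdef, ← hn]
    by_cases h : ‖y‖ < R
    · simp [Set.indicator, ball3, h]
    · simp [Set.indicator, ball3, h]
  have he : ‖d⁻¹ • x‖ = 1 := by
    rw [norm_smul, ← hd, Real.norm_of_nonneg (by positivity)]
    field_simp
  rw [s1, polar_integral' K hK _ he]
  have hmeas : Measurable fun p : ℝ × ℝ =>
      (max (2 * π * p.1 * (p.1 * sin p.2)) 0) • K (p.1, p.1 * cos p.2) := by fun_prop
  have hh : Integrable (fun r => Set.indicator (Set.Ioo 0 R) (fun r => ρ r * (r : ℂ) ^ 2) r)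
      (volume.restrict (Set.Ioi (0 : ℝ))) := by
    apply Integrable.restrict
    rw [integrable_indicator_iff measurableSet_Ioo]
    exact hρ_int.mono_set Set.Ioo_subset_Icc_self
  have hint : IntegrableOn (fun p : ℝ × ℝ =>
      (max (2 * π * p.1 * (p.1 * sin p.2)) 0) • K (p.1, p.1 * cos p.2))
      (Set.Ioi (0 : ℝ) ×ˢ Set.Ioo (-π) π) (volume.prod volume) := by
    have hb := ((hh.norm.const_mul (1 / (2 * (d - R)))).comp_fst
      (volume.restrict (Set.Ioo (-π) π)))
    rw [Measure.prod_restrict] at hb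
    refine Integrable.mono' hb hmeas.aestronglyMeasurable ?_
    refine (ae_restrict_iff' (measurableSet_Ioi.prod measurableSet_Ioo)).2
      (Filter.Eventually.of_forall ?_)
    rintro ⟨r, θ⟩ ⟨hr, hθ⟩
    simp only [Set.mem_Ioi] at hr
    by_cases h : r < R
    · have hu := u_bound d r (cos θ) hr.le (h.trans hx) (cos_le_one θ)
      have hdR : 0 < d - R := sub_pos.2 hx
      have e1 : K (r, r * cos θ) = (Complex.exp (Complex.I * (κ : ℂ) *
        (√ (d ^ 2 + r ^ 2 - 2 * d * (r * cos θ)) : ℝ)) /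
        ((4 * π * √ (d ^ 2 + r ^ 2 - 2 * d * (r * cos θ)) : ℝ) : ℂ)) * ρ r := by
        simp [hKdef, h]
      simp only [e1]
      generalize √ (d ^ 2 + r ^ 2 - 2 * d * (r * cos θ)) = u at hu
      have hu0 : 0 < u := by linarith
      have e2 : ‖Complex.exp (Complex.I * (κ : ℂ) * (u : ℝ))‖ = 1 := by
        rw [Complex.norm_exp]; simp
      have e3 : Set.indicator (Set.Ioo 0 R) (fun r => ρ r * (r : ℂ) ^ 2) r = ρ r * (r : ℂ) ^ 2 :=
        Set.indicator_of_mem (show r ∈ Set.Ioo 0 R from ⟨hr, h⟩) _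
      rw [e3, norm_smul, norm_mul, norm_mul, norm_div, e2, Complex.norm_real, norm_pow,
        Complex.norm_real, Real.norm_of_nonneg (le_max_right _ _),
        Real.norm_of_nonneg (by positivity : 0 ≤ 4 * π * u), Real.norm_of_nonneg hr.le]
      have m1 : max (2 * π * r * (r * sin θ)) 0 ≤ 2 * π * r ^ 2 := by
        apply max_le _ (by positivity)
        have : 0 ≤ 2 * π * r ^ 2 * (1 - sin θ) :=
          mul_nonneg (by positivity) (sub_nonneg.2 (sin_le_one θ))
        linarith
      have m2 : 1 / (4 * π * u) ≤ 1 / (4 * π * (d - R)) := by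
        gcongr; linarith
      calc _ ≤ 2 * π * r ^ 2 * (1 / (4 * π * (d - R)) * ‖ρ r‖) := by gcongr
        _ = _ := by field_simp; ring
    · have : K (r, r * cos θ) = 0 := by simp [hKdef, h]
      simp only [this, smul_zero, norm_zero]
      have hdR : 0 < d - R := sub_pos.2 hx
      positivity
  rw [polarCoord_target, Measure.volume_eq_prod, setIntegral_prod _ hint]
  have hin : ∀ r ∈ Set.Ioi (0 : ℝ), ∫ θ in Set.Ioo (-π) π,
      (max (2 * π * r * (r * sin θ)) 0) • K (r, r * cos θ) =
      Set.indicator (Set.Ioo 0 R) (fun r => (Complex.exp (Complex.I * (κ : ℂ) * (d : ℂ)) /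
        ((κ * d : ℝ) : ℂ)) * (ρ r * ((Real.sin (κ * r) : ℝ) : ℂ) * (r : ℂ))) r := by
    intro r hr
    simp only [Set.mem_Ioi] at hr
    by_cases h : r < R
    · rw [Set.indicator_of_mem (show r ∈ Set.Ioo 0 R from ⟨hr, h⟩)]
      rw [setIntegral_eq_of_subset_of_forall_sdiff_eq_zero (s := Set.Ioo 0 π) (t := Set.Ioo (-π) π)
        measurableSet_Ioo (Set.Ioo_subset_Ioo_left (by linarith [pi_pos]))]
      · have : ∀ θ ∈ Set.Ioo 0 π, (max (2 * π * r * (r * sin θ)) 0) • K (r, r * cos θ) =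
            (2 * π * r ^ 2 * ρ r : ℂ) * ((sin θ : ℂ) *
      (Complex.exp (Complex.I * κ * (√ (d ^ 2 + r ^ 2 - 2 * d * (r * cos θ)) : ℝ)) /
        ((4 * π * √ (d ^ 2 + r ^ 2 - 2 * d * (r * cos θ)) : ℝ) : ℂ))) := by
          intro θ hθ
          have hs := sin_pos_of_pos_of_lt_pi hθ.1 hθ.2
          rw [max_eq_left (by positivity)]
          have e1 : K (r, r * cos θ) = (Complex.exp (Complex.I * (κ : ℂ) *
            (√ (d ^ 2 + r ^ 2 - 2 * d * (r * cos θ)) : ℝ)) /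
            ((4 * π * √ (d ^ 2 + r ^ 2 - 2 * d * (r * cos θ)) : ℝ) : ℂ)) * ρ r := by
            simp [hKdef, h]
          rw [e1, Complex.real_smul, Complex.ofReal_mul, Complex.ofReal_mul (2 * π),
            Complex.ofReal_mul r]
          push_cast
          ring
        rw [setIntegral_congr_fun measurableSet_Ioo this, integral_const_mul,
          ← integral_Ioc_eq_integral_Ioo, ← intervalIntegral.integral_of_le pi_pos.le,
          inner_theta κ d r hκ hr (h.trans hx)]
        have hcd : (d : ℂ) ≠ 0 := by exact_mod_cast hd0.ne'
        have hcr : (r : ℂ) ≠ 0 := by exact_mod_cast hr.ne'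
        have hcκ : (κ : ℂ) ≠ 0 := by exact_mod_cast hκ.ne'
        have hcπ : (π : ℂ) ≠ 0 := by exact_mod_cast pi_ne_zero
        push_cast
        field_simp
      · rintro θ ⟨h1, h2⟩
        have : θ ≤ 0 := by
          by_contra h3
          exact h2 ⟨not_le.1 h3, h1.2⟩
        have hs := sin_nonpos_of_nonpos_of_neg_pi_le this h1.1.le
        rw [max_eq_right, zero_smul]
        exact mul_nonpos_of_nonneg_of_nonpos (by positivity)
          (mul_nonpos_of_nonneg_of_nonpos hr.le hs)
    · rw [Set.indicator_of_notMem (fun hh => h hh.2)]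
      have : ∀ θ, K (r, r * cos θ) = 0 := fun θ => by simp [hKdef, h]
      simp [this]
  rw [setIntegral_congr_fun measurableSet_Ioi hin, setIntegral_indicator measurableSet_Ioo,
    Set.inter_eq_right.2 Set.Ioo_subset_Ioi_self, integral_const_mul,
    intervalIntegral.integral_of_le hR.le, integral_Ioc_eq_integral_Ioo]
end
end

section
/- For every x ∈ ℝ³ with ‖x‖ > R, the modified Helmholtz potential of a radial density is given by the one-dimensional integral: ∫_{B_R} (e^{−κ‖x−y‖}/(4π‖x−y‖)) ρ(‖y‖) dy = (e^{−κ‖x‖}/(κ‖x‖)) ∫_0^R ρ(r) sinh(κr) r dr. -/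
open MeasureTheory Real

noncomputable section

lemma h_stepA (f : ℝ → ℝ → ℝ → ENNReal) (hf : Measurable fun q : ℝ × (ℝ × ℝ) => f q.1 q.2.1 q.2.2) :
    ∫⁻ y : E3, f (y 0) (y 1) (y 2) = ∫⁻ z : ℝ, ∫⁻ p : ℝ × ℝ, f z p.1 p.2 := by
  have e1 := EuclideanSpace.volume_preserving_symm_measurableEquiv_toLp (Fin 3)
  have e2 := volume_preserving_piFinSuccAbove (fun _ : Fin 3 => ℝ) 0
  have e3 := (MeasurePreserving.id (volume : Measure ℝ)).prod (volume_preserving_finTwoArrow ℝ)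
  have e := e3.comp (e2.comp e1)
  have h := e.lintegral_comp hf
  rw [Measure.volume_eq_prod, lintegral_prod _ hf.aemeasurable] at h
  exact h

lemma h_stepB (h : ℝ → ENNReal) (hh : Measurable h) :
    ∫⁻ p : ℝ × ℝ, h (√(p.1 ^ 2 + p.2 ^ 2)) =
      ∫⁻ s in Set.Ioi (0:ℝ), ENNReal.ofReal (2 * π * s) * h s := by
  rw [← lintegral_comp_polarCoord_symm]
  have : ∀ p ∈ polarCoord.target, ENNReal.ofReal p.1 •
      h (√((polarCoord.symm p).1 ^ 2 + (polarCoord.symm p).2 ^ 2)) = (ENNReal.ofReal p.1 * h p.1) * 1 := by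
    intro p hp
    have hp1 : 0 < p.1 := hp.1
    have : (polarCoord.symm p).1 ^ 2 + (polarCoord.symm p).2 ^ 2 = p.1 ^ 2 := by
      simp only [polarCoord_symm_apply]
      nlinarith [Real.sin_sq_add_cos_sq p.2]
    rw [this, Real.sqrt_sq hp1.le, smul_eq_mul, mul_one]
  rw [setLIntegral_congr_fun polarCoord.open_target.measurableSet this]
  change ∫⁻ p in Set.Ioi (0:ℝ) ×ˢ Set.Ioo (-π) π, _ = _
  rw [Measure.volume_eq_prod, ← Measure.prod_restrict,
    lintegral_prod_mul (f := fun r => ENNReal.ofReal r * h r) (g := fun _ => 1) (by fun_prop) (by fun_prop)]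
  rw [← lintegral_mul_const _ (by fun_prop)]
  refine setLIntegral_congr_fun measurableSet_Ioi fun s hs => ?_
  simp only [lintegral_const, one_mul, Measure.restrict_apply, MeasurableSet.univ, Set.univ_inter, Real.volume_Ioo]
  rw [mul_right_comm, ← ENNReal.ofReal_mul (le_of_lt hs)]
  congr 2; ring

lemma h_lint (g : ℝ × ℝ → ENNReal) (hg : Measurable g) :
    ∫⁻ y : E3, g (‖y‖, y 0) = ∫⁻ p in Set.Ioi (0:ℝ) ×ˢ Set.Ioo 0 π,
      ENNReal.ofReal (2 * π * p.1 ^ 2 * Real.sin p.2) * g (p.1, p.1 * Real.cos p.2) := by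
  have h1 : ∀ y : E3, g (‖y‖, y 0) = g (√((y 0) ^ 2 + (√((y 1) ^ 2 + (y 2) ^ 2)) ^ 2), y 0) := by
    intro y
    rw [Real.sq_sqrt (by positivity), EuclideanSpace.norm_eq]
    simp [Fin.sum_univ_three, add_assoc]
  simp_rw [h1]
  rw [h_stepA (fun z a b => g (√(z ^ 2 + (√(a ^ 2 + b ^ 2)) ^ 2), z)) (by fun_prop)]
  have h2 : ∀ z : ℝ, ∫⁻ p : ℝ × ℝ, g (√(z ^ 2 + (√(p.1 ^ 2 + p.2 ^ 2)) ^ 2), z) =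
      ∫⁻ s : ℝ, (Set.Ioi (0:ℝ)).indicator (fun s => ENNReal.ofReal (2 * π * s) * g (√(z ^ 2 + s ^ 2), z)) s := by
    intro z
    rw [h_stepB (fun s => g (√(z ^ 2 + s ^ 2), z)) (by fun_prop), lintegral_indicator measurableSet_Ioi]
  simp_rw [h2]
  set G : ℝ × ℝ → ENNReal := ({p : ℝ × ℝ | 0 < p.2}).indicator
    (fun p => ENNReal.ofReal (2 * π * p.2) * g (√(p.1 ^ 2 + p.2 ^ 2), p.1)) with hG
  have hGm : Measurable G := by
    apply Measurable.indicator (by fun_prop)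
    exact measurableSet_lt measurable_const measurable_snd
  have h3 : ∫⁻ p, G p = ∫⁻ z : ℝ, ∫⁻ s : ℝ, G (z, s) := by
    rw [Measure.volume_eq_prod, lintegral_prod _ hGm.aemeasurable]
  have h4 : ∀ z s : ℝ, (Set.Ioi (0:ℝ)).indicator (fun s => ENNReal.ofReal (2 * π * s) * g (√(z ^ 2 + s ^ 2), z)) s = G (z, s) := by
    intro z s
    simp [hG, Set.indicator]
  simp_rw [h4]
  rw [← h3, ← lintegral_comp_polarCoord_symm]
  change ∫⁻ p in Set.Ioi (0:ℝ) ×ˢ Set.Ioo (-π) π, _ = _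
  rw [← lintegral_indicator (measurableSet_Ioi.prod measurableSet_Ioo),
    ← lintegral_indicator (measurableSet_Ioi.prod measurableSet_Ioo)]
  congr 1
  ext ⟨r, t⟩
  by_cases hr : 0 < r
  swap
  · simp [Set.indicator, hr]
  by_cases ht : t ∈ Set.Ioo (-π) π
  swap
  · have : ¬ (t ∈ Set.Ioo 0 π) := fun h => ht ⟨by linarith [h.1, pi_pos], h.2⟩
    rw [Set.indicator_of_notMem (by simp only [Set.mem_prod]; tauto), Set.indicator_of_notMem (by simp only [Set.mem_prod]; tauto)]
  rw [Set.indicator_of_mem (by exact ⟨hr, ht⟩)]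
  have hsq : (r * Real.cos t) ^ 2 + (r * Real.sin t) ^ 2 = r ^ 2 := by
    nlinarith [Real.sin_sq_add_cos_sq t]
  by_cases ht0 : 0 < t
  · rw [Set.indicator_of_mem (by exact ⟨hr, ht0, ht.2⟩)]
    have hs := Real.sin_pos_of_pos_of_lt_pi ht0 ht.2
    rw [hG, Set.indicator_of_mem (by simp only [polarCoord_symm_apply]; exact mul_pos hr hs)]
    simp only [polarCoord_symm_apply, hsq, Real.sqrt_sq hr.le, smul_eq_mul]
    rw [← mul_assoc, ← ENNReal.ofReal_mul hr.le]
    congr 2; ring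
  · rw [Set.indicator_of_notMem (fun h => ht0 h.2.1)]
    have hs := Real.sin_nonpos_of_nonpos_of_neg_pi_le (not_lt.1 ht0) ht.1.le
    rw [hG, Set.indicator_of_notMem (by simp only [polarCoord_symm_apply]; exact not_lt.2 (mul_nonpos_of_nonneg_of_nonpos hr.le hs))]
    simp

lemma h_map : Measure.map (fun y : E3 => (‖y‖, y 0)) volume =
    Measure.map (fun p : ℝ × ℝ => (p.1, p.1 * Real.cos p.2))
      ((volume.restrict (Set.Ioi (0:ℝ) ×ˢ Set.Ioo 0 π)).withDensity
        (fun p => ENNReal.ofReal (2 * π * p.1 ^ 2 * Real.sin p.2))) := by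
  have hm : Measurable (fun y : E3 => (‖y‖, y 0)) := by fun_prop
  refine Measure.ext_of_lintegral _ fun g hg => ?_
  rw [lintegral_map hg hm, lintegral_map hg (by fun_prop), h_lint g hg,
    lintegral_withDensity_eq_lintegral_mul _ (by fun_prop) (by fun_prop)]
  rfl

lemma h_int (g : ℝ × ℝ → ℂ) (hg : Measurable g) :
    ∫ y : E3, g (‖y‖, y 0) = ∫ p in Set.Ioi (0:ℝ) ×ˢ Set.Ioo 0 π,
      (2 * π * p.1 ^ 2 * Real.sin p.2) • g (p.1, p.1 * Real.cos p.2) := by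
  have hm : Measurable (fun y : E3 => (‖y‖, y 0)) := by fun_prop
  rw [← integral_map (f := g) hm.aemeasurable hg.aestronglyMeasurable, h_map,
    integral_map (f := g) (by fun_prop) hg.aestronglyMeasurable,
    integral_withDensity_eq_integral_toReal_smul (by fun_prop) (by simp)]
  refine setIntegral_congr_fun (measurableSet_Ioi.prod measurableSet_Ioo) fun p hp => ?_
  have hs := Real.sin_pos_of_pos_of_lt_pi hp.2.1 hp.2.2
  have := pi_pos
  rw [ENNReal.toReal_ofReal (by positivity)]

lemma h_angle (κ X r : ℝ) (hκ : 0 < κ) (hr : 0 < r) (hX : r < X) :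
    ∫ t in (0:ℝ)..π, Real.exp (-(κ * √(X ^ 2 + r ^ 2 - 2 * X * (r * Real.cos t)))) /
      (√(X ^ 2 + r ^ 2 - 2 * X * (r * Real.cos t))) * Real.sin t =
    2 * Real.exp (-(κ * X)) * Real.sinh (κ * r) / (κ * X * r) := by
  have hX0 : 0 < X := hr.trans hX
  have hpos : ∀ t : ℝ, 0 < X ^ 2 + r ^ 2 - 2 * X * (r * Real.cos t) := by
    intro t
    nlinarith [Real.cos_le_one t, mul_pos hX0 hr, sq_pos_of_pos (sub_pos.2 hX)]
  have hd : ∀ t ∈ Set.uIcc 0 π, HasDerivAt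
      (fun t => -(Real.exp (-(κ * √(X ^ 2 + r ^ 2 - 2 * X * (r * Real.cos t))))) / (κ * X * r))
      (Real.exp (-(κ * √(X ^ 2 + r ^ 2 - 2 * X * (r * Real.cos t)))) /
      (√(X ^ 2 + r ^ 2 - 2 * X * (r * Real.cos t))) * Real.sin t) t := by
    intro t _
    have h1 : HasDerivAt (fun t => X ^ 2 + r ^ 2 - 2 * X * (r * Real.cos t))
        (-(2 * X * (r * (-Real.sin t)))) t :=
      (((Real.hasDerivAt_cos t).const_mul r).const_mul (2 * X)).const_sub _
    have h2 := ((((h1.sqrt (hpos t).ne').const_mul κ).fun_neg.exp).fun_neg).div_const (κ * X * r)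
    refine h2.congr_deriv ?_
    have := Real.sqrt_pos.2 (hpos t)
    generalize √(X ^ 2 + r ^ 2 - 2 * X * (r * Real.cos t)) = D at *
    field_simp
  have hc : Continuous fun t => Real.exp (-(κ * √(X ^ 2 + r ^ 2 - 2 * X * (r * Real.cos t)))) /
      (√(X ^ 2 + r ^ 2 - 2 * X * (r * Real.cos t))) * Real.sin t := by
    refine Continuous.mul (Continuous.div (by fun_prop) (by fun_prop) fun t => (Real.sqrt_pos.2 (hpos t)).ne') (by fun_prop)
  rw [intervalIntegral.integral_eq_sub_of_hasDerivAt hd (hc.intervalIntegrable _ _)]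
  have a1 : X ^ 2 + r ^ 2 - 2 * X * (r * Real.cos π) = (X + r) ^ 2 := by rw [Real.cos_pi]; ring
  have a2 : X ^ 2 + r ^ 2 - 2 * X * (r * Real.cos 0) = (X - r) ^ 2 := by rw [Real.cos_zero]; ring
  rw [a1, a2, Real.sqrt_sq (by linarith), Real.sqrt_sq (by linarith), Real.sinh_eq]
  rw [show -(κ * (X + r)) = -(κ * X) + -(κ * r) by ring, show -(κ * (X - r)) = -(κ * X) + (κ * r) by ring,
    Real.exp_add, Real.exp_add]
  ring

def h_D (X : ℝ) (p : ℝ × ℝ) : ℝ := √(X ^ 2 + p.1 ^ 2 - 2 * X * p.2)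

open Classical in
def h_g (κ R X : ℝ) (ρ : ℝ → ℂ) (p : ℝ × ℝ) : ℂ :=
  if p.1 < R then ((Real.exp (-(κ * h_D X p)) / (4 * π * h_D X p) : ℝ) : ℂ) * ρ p.1 else 0

lemma h_D_meas (X : ℝ) : Measurable (h_D X) := by unfold h_D; fun_prop

lemma h_dist (X : ℝ) (w : E3) : ‖EuclideanSpace.single 0 X - w‖ = h_D X (‖w‖, w 0) := by
  unfold h_D
  rw [EuclideanSpace.norm_eq, EuclideanSpace.norm_eq w, Real.sq_sqrt (by positivity)]
  congr 1
  simp [Fin.sum_univ_three]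
  ring

lemma h_g_meas (κ R X : ℝ) (ρ : ℝ → ℂ) (hρ : Measurable ρ) : Measurable (h_g κ R X ρ) := by
  unfold h_g
  have := h_D_meas X
  refine Measurable.ite (measurableSet_lt measurable_fst measurable_const) (by fun_prop) (by fun_prop)

lemma h_g_int (κ R X : ℝ) (hκ : 0 < κ) (hR : 0 < R) (hX : R < X)
    (ρ : ℝ → ℂ) (hρ_meas : Measurable ρ)
    (hρ_int : IntegrableOn (fun r : ℝ => ρ r * (r : ℂ) ^ 2) (Set.Icc 0 R)) :
    IntegrableOn (fun p : ℝ × ℝ => (2 * π * p.1 ^ 2 * Real.sin p.2) • h_g κ R X ρ (p.1, p.1 * Real.cos p.2))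
      (Set.Ioi (0:ℝ) ×ˢ Set.Ioo 0 π) ((volume : Measure ℝ).prod volume) := by
  have hpi := pi_pos
  have i1 : Integrable ((Set.Icc 0 R).indicator (fun r : ℝ => ρ r * (r : ℂ) ^ 2)) (volume.restrict (Set.Ioi 0)) :=
    (hρ_int.integrable_indicator measurableSet_Icc).restrict
  have i2 : Integrable (fun _ : ℝ => (1 : ℂ)) (volume.restrict (Set.Ioo 0 π)) := integrable_const _
  have i3 := i1.mul_prod i2
  rw [Measure.prod_restrict] at i3
  have hb := h_g_meas κ R X (fun _ => 1) measurable_const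
  have i4 := Integrable.bdd_mul (c := 2 * π * (1 / (4 * π * (X - R)))) i3
    (f := fun p : ℝ × ℝ => (((2 * π * Real.sin p.2 : ℝ)) : ℂ) * h_g κ R X (fun _ => 1) (p.1, p.1 * Real.cos p.2))
    (by apply Measurable.aestronglyMeasurable; fun_prop) ?_
  · refine i4.congr ?_
    refine (ae_restrict_iff' (measurableSet_Ioi.prod measurableSet_Ioo)).2 (ae_of_all _ ?_)
    rintro ⟨r, t⟩ ⟨hr, ht⟩
    have hr : 0 < r := hr
    by_cases hrR : r < R
    · have : r ∈ Set.Icc 0 R := ⟨hr.le, hrR.le⟩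
      simp [h_g, hrR, Set.indicator_of_mem this]
      ring
    · simp [h_g, hrR]
  · refine (ae_restrict_iff' (measurableSet_Ioi.prod measurableSet_Ioo)).2 (ae_of_all _ ?_)
    rintro ⟨r, t⟩ ⟨hr, ht⟩
    have hr : 0 < r := hr
    have hXR := sub_pos.2 hX
    rw [norm_mul]
    refine mul_le_mul ?_ ?_ (norm_nonneg _) (by positivity)
    · rw [Complex.norm_real, Real.norm_eq_abs, abs_mul, abs_of_pos (by positivity)]
      have := Real.abs_sin_le_one t
      nlinarith
    · by_cases hrR : r < R
      · have hD : X - R ≤ h_D X (r, r * Real.cos t) := by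
          unfold h_D
          apply Real.le_sqrt_of_sq_le
          have : 0 < X * r := mul_pos (hR.trans hX) hr
          simp only
          nlinarith [Real.cos_le_one t]
        have hD0 : 0 < h_D X (r, r * Real.cos t) := hXR.trans_le hD
        simp only [h_g, hrR, if_true, mul_one]
        rw [Complex.norm_real, Real.norm_eq_abs, abs_of_nonneg (by positivity)]
        apply div_le_div₀ zero_le_one _ (by positivity) (by gcongr)
        apply Real.exp_le_one_iff.2
        have : 0 ≤ κ * h_D X (r, r * Real.cos t) := by positivity
        linarith
      · simp [h_g, hrR]
        positivity

theorem modified_helmholtz_potential_radial_density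
    (κ R : ℝ) (hκ : 0 < κ) (hR : 0 < R)
    (ρ : ℝ → ℂ) (hρ_meas : Measurable ρ)
    (hρ_int : IntegrableOn (fun r : ℝ => ρ r * (r : ℂ) ^ 2) (Set.Icc 0 R)) :
    ∀ x : E3, R < ‖x‖ →
      (∫ y in ball3 R,
        (((Real.exp (-(κ * ‖x - y‖)) / (4 * π * ‖x - y‖) : ℝ)) : ℂ) * ρ ‖y‖) =
      (((Real.exp (-(κ * ‖x‖)) : ℝ) : ℂ) / ((κ * ‖x‖ : ℝ) : ℂ)) *
        ∫ r in (0 : ℝ)..R, ρ r * ((Real.sinh (κ * r) : ℝ) : ℂ) * (r : ℂ) := by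
  intro x hx
  have hX0 : 0 < ‖x‖ := hR.trans hx
  set X := ‖x‖ with hXdef
  -- rotate
  obtain ⟨A, hA⟩ : ∃ A : E3 ≃ₗᵢ[ℝ] E3, A x = EuclideanSpace.single 0 X :=
    ⟨_, Submodule.reflection_sub (v := x) (w := EuclideanSpace.single 0 X) (by simp [hXdef])⟩
  have h1 : (∫ y in ball3 R,
        (((Real.exp (-(κ * ‖x - y‖)) / (4 * π * ‖x - y‖) : ℝ)) : ℂ) * ρ ‖y‖) =
      ∫ y : E3, h_g κ R X ρ (‖y‖, y 0) := by
    have hb : MeasurableSet (ball3 R) := measurableSet_lt measurable_norm measurable_const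
    rw [← integral_indicator hb, ← A.measurePreserving.integral_comp A.toHomeomorph.measurableEmbedding
      (fun y : E3 => h_g κ R X ρ (‖y‖, y 0))]
    congr 1
    ext y
    have hn : ‖x - y‖ = h_D X (‖A y‖, A y 0) := by
      rw [← A.norm_map (x - y), map_sub, hA, h_dist]
    simp only [h_g, Set.indicator, ball3, Set.mem_ofPred_eq, hn]
    simp only [LinearIsometryEquiv.norm_map]
  rw [h1, h_int _ (h_g_meas κ R X ρ hρ_meas), Measure.volume_eq_prod, setIntegral_prod _ (h_g_int κ R X hκ hR hx ρ hρ_meas hρ_int)]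
  rw [intervalIntegral.integral_of_le hR.le, integral_Ioc_eq_integral_Ioo, ← integral_const_mul,
    ← Set.Ioi_inter_Iio (a := 0) (b := R), ← setIntegral_indicator measurableSet_Iio]
  refine setIntegral_congr_fun measurableSet_Ioi fun r hr => ?_
  have hr : 0 < r := hr
  by_cases hrR : r < R
  · have hrX : r < X := hrR.trans hx
    have key := h_angle κ X r hκ hr hrX
    rw [Set.indicator_of_mem (by exact hrR)]
    have : ∀ t : ℝ, (2 * π * r ^ 2 * Real.sin t) • h_g κ R X ρ (r, r * Real.cos t) =
        (((Real.exp (-(κ * √(X ^ 2 + r ^ 2 - 2 * X * (r * Real.cos t)))) /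
      (√(X ^ 2 + r ^ 2 - 2 * X * (r * Real.cos t))) * Real.sin t : ℝ)) : ℂ) * (((r ^ 2 / 2 : ℝ) : ℂ) * ρ r) := by
      intro t
      have h2 : h_g κ R X ρ (r, r * Real.cos t) = ((Real.exp (-(κ * h_D X (r, r * Real.cos t))) / (4 * π * h_D X (r, r * Real.cos t)) : ℝ) : ℂ) * ρ r := if_pos hrR
      rw [h2, Complex.real_smul, ← mul_assoc, ← mul_assoc, ← Complex.ofReal_mul, ← Complex.ofReal_mul]
      congr 2
      unfold h_D
      have := pi_pos
      simp only
      generalize √(X ^ 2 + r ^ 2 - 2 * X * (r * Real.cos t)) = D at *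
      rw [mul_comm (4 * π) D, ← div_div]
      field_simp
      ring
    simp_rw [this]
    rw [integral_mul_const, integral_complex_ofReal, ← integral_Ioc_eq_integral_Ioo, ← intervalIntegral.integral_of_le pi_pos.le, key]
    push_cast
    have : (r : ℂ) ≠ 0 := by exact_mod_cast hr.ne'
    have : (X : ℂ) ≠ 0 := by exact_mod_cast hX0.ne'
    have : (κ : ℂ) ≠ 0 := by exact_mod_cast hκ.ne'
    field_simp
  · rw [Set.indicator_of_notMem (by exact hrR)]
    simp [h_g, hrR]
end
end

section
/- Let j₀(t) = sin t / t (with j₀(0) = 1). For every x ∈ ℝ³ with ‖x‖ > R, the convolution of the spherical Bessel kernel with a radial density satisfies: ∫_{B_R} j₀(κ‖x−y‖) ρ(‖y‖) dy = 4π j₀(κ‖x‖) ∫_0^R ρ(r) j₀(κr) r² dr. -/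
open MeasureTheory Real

noncomputable section

/-- The spherical Bessel function of order zero. -/
def j0 (t : ℝ) : ℝ := if t = 0 then 1 else Real.sin t / t

abbrev E2 := EuclideanSpace ℝ (Fin 2)
abbrev W3 := WithLp 2 (ℝ × E2)

lemma exists_iso (x : E3) : ∃ L : E3 ≃ₗᵢ[ℝ] W3, L x = WithLp.toLp 2 (‖x‖, (0 : E2)) := by
  have hf : Module.finrank ℝ W3 = 3 := by
    rw [(WithLp.linearEquiv 2 ℝ (ℝ × E2)).finrank_eq]
    simp
  let L0 : E3 ≃ₗᵢ[ℝ] W3 := ((stdOrthonormalBasis ℝ W3).reindex (finCongr hf)).repr.symm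
  have hn : ‖L0 x‖ = ‖(WithLp.toLp 2 (‖x‖, (0 : E2)) : W3)‖ := by
    rw [L0.norm_map, WithLp.prod_norm_eq_of_L2]
    simp
  exact ⟨L0.trans (Submodule.reflection (Submodule.span ℝ {L0 x - WithLp.toLp 2 (‖x‖, (0 : E2))})ᗮ),
    by simpa using Submodule.reflection_sub hn⟩

lemma norm_W3 (z : ℝ) (w : E2) : ‖(WithLp.toLp 2 (z, w) : W3)‖ = √(z ^ 2 + ‖w‖ ^ 2) := by
  rw [WithLp.prod_norm_eq_of_L2]; simp

/-- Cylindrical decomposition. -/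
lemma cyl (x : E3) (G : ℝ → ℝ → ℂ)
    (hint : Integrable (fun y : E3 => G ‖x - y‖ ‖y‖)) :
    ∫ y : E3, G ‖x - y‖ ‖y‖ =
      ∫ z : ℝ, ∫ w : E2, G (√((‖x‖ - z) ^ 2 + ‖w‖ ^ 2)) (√(z ^ 2 + ‖w‖ ^ 2)) := by
  obtain ⟨L, hL⟩ := exists_iso x
  have hmp : MeasurePreserving (fun p : ℝ × E2 => L.symm (WithLp.toLp 2 p)) :=
    L.symm.measurePreserving.comp (WithLp.volume_preserving_toLp ℝ E2)
  have hemb : MeasurableEmbedding (fun p : ℝ × E2 => L.symm (WithLp.toLp 2 p)) :=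
    L.symm.toHomeomorph.measurableEmbedding.comp
      (MeasurableEquiv.toLp 2 (ℝ × E2)).measurableEmbedding
  have key : ∀ p : ℝ × E2, G ‖x - L.symm (WithLp.toLp 2 p)‖ ‖L.symm (WithLp.toLp 2 p)‖ =
      G (√((‖x‖ - p.1) ^ 2 + ‖p.2‖ ^ 2)) (√(p.1 ^ 2 + ‖p.2‖ ^ 2)) := by
    rintro ⟨z, w⟩
    have h1 : ‖x - L.symm (WithLp.toLp 2 (z, w))‖ = √((‖x‖ - z) ^ 2 + ‖w‖ ^ 2) := by
      rw [← L.norm_map, map_sub, hL, L.apply_symm_apply, ← WithLp.toLp_sub, Prod.mk_sub_mk,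
        norm_W3]
      simp
    rw [h1, L.symm.norm_map, norm_W3]
  have hi2 := (hmp.integrable_comp_emb hemb).2 hint
  rw [← hmp.integral_comp hemb]
  simp only [Function.comp_def, key] at hi2 ⊢
  rw [Measure.volume_eq_prod] at hi2 ⊢
  rw [integral_prod _ hi2]

lemma radial2 (f : ℝ → ℂ) : ∫ w : E2, f ‖w‖ = (2 * π : ℝ) * ∫ s in Set.Ioi (0 : ℝ), s * f s := by
  rw [integral_fun_norm_addHaar]
  simp [Measure.real, EuclideanSpace.volume_ball_fin_two, Real.pi_pos.le]
  ring

/-- Change of variables `r = √(z² + s²)`. -/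
lemma chvar (z : ℝ) (f : ℝ → ℂ) :
    ∫ s in Set.Ioi (0 : ℝ), s * f (√(z ^ 2 + s ^ 2)) = ∫ r in Set.Ioi |z|, r * f r := by
  have himg : (fun s => √(z ^ 2 + s ^ 2)) '' Set.Ioi (0 : ℝ) = Set.Ioi |z| := by
    ext r
    simp only [Set.mem_image, Set.mem_Ioi]
    constructor
    · rintro ⟨s, hs, rfl⟩
      apply Real.lt_sqrt_of_sq_lt
      rw [sq_abs]; nlinarith
    · intro hr
      have h0 : 0 < r := (abs_nonneg z).trans_lt hr
      have h1 : z ^ 2 < r ^ 2 := by rw [← sq_abs]; gcongr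
      refine ⟨√(r ^ 2 - z ^ 2), Real.sqrt_pos.2 (by linarith), ?_⟩
      rw [Real.sq_sqrt (by linarith)]
      rw [show z ^ 2 + (r ^ 2 - z ^ 2) = r ^ 2 by ring, Real.sqrt_sq h0.le]
  rw [← himg, integral_image_eq_integral_abs_deriv_smul (f' := fun s => s / √(z ^ 2 + s ^ 2))
    measurableSet_Ioi]
  · apply setIntegral_congr_fun measurableSet_Ioi
    intro s (hs : 0 < s)
    have hp : 0 < √(z ^ 2 + s ^ 2) := Real.sqrt_pos.2 (by positivity)
    have hp' : ((√(z ^ 2 + s ^ 2) : ℝ) : ℂ) ≠ 0 := by exact_mod_cast hp.ne'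
    simp only [abs_of_pos (div_pos hs hp), Complex.real_smul, Complex.ofReal_div]
    field_simp
  · intro s (hs : 0 < s)
    have h := (((hasDerivAt_id s).pow 2).const_add (z ^ 2)).sqrt (by simp; positivity)
    refine HasDerivAt.hasDerivWithinAt (HasDerivAt.congr_deriv h ?_)
    simp
    field_simp
  · intro s (hs : 0 < s) t (ht : 0 < t) h
    have h := (Real.sqrt_inj (by positivity) (by positivity)).1 h
    have : s ^ 2 = t ^ 2 := by linarith
    exact (pow_left_inj₀ hs.le ht.le two_ne_zero).1 this

lemma j0_le (t : ℝ) : |j0 t| ≤ 1 := by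
  unfold j0
  split_ifs with h
  · simp
  · rw [abs_div, div_le_one (abs_pos.2 h)]
    exact Real.abs_sin_le_abs

lemma j0_meas : Measurable j0 := by
  unfold j0
  exact Measurable.ite (measurableSet_singleton 0) measurable_const (by fun_prop)

/-- The one-dimensional integral. -/
lemma inner_int (κ a r : ℝ) (hκ : 0 < κ) (hr : 0 < r) (hra : r < a) :
    ∫ z in (-r)..r, j0 (κ * √(a ^ 2 - 2 * a * z + r ^ 2)) = 2 * r * (j0 (κ * a) * j0 (κ * r)) := by
  have ha : 0 < a := hr.trans hra
  have hpos : ∀ z ∈ Set.uIcc (-r) r, 0 < a ^ 2 - 2 * a * z + r ^ 2 := by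
    intro z hz
    rw [Set.uIcc_of_le (by linarith)] at hz
    nlinarith [hz.2, mul_le_mul_of_nonneg_left hz.2 ha.le, sq_pos_of_pos (sub_pos.2 hra)]
  have hd : ∀ z ∈ Set.uIcc (-r) r,
      HasDerivAt (fun z => Real.cos (κ * √(a ^ 2 - 2 * a * z + r ^ 2)) / (a * κ ^ 2))
      (j0 (κ * √(a ^ 2 - 2 * a * z + r ^ 2))) z := by
    intro z hz
    have hp := hpos z hz
    have hs : 0 < √(a ^ 2 - 2 * a * z + r ^ 2) := Real.sqrt_pos.2 hp
    have h := ((((((hasDerivAt_id z).const_mul (2 * a)).const_sub (a ^ 2)).add_const (r ^ 2)).sqrt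
      hp.ne').const_mul κ).cos.div_const (a * κ ^ 2)
    refine HasDerivAt.congr_deriv h ?_
    simp only [j0]
    rw [if_neg (by positivity)]
    simp only [id]
    field_simp
  have hc : ContinuousOn (fun z => j0 (κ * √(a ^ 2 - 2 * a * z + r ^ 2))) (Set.uIcc (-r) r) := by
    have : ContinuousOn (fun z => Real.sin (κ * √(a ^ 2 - 2 * a * z + r ^ 2)) /
        (κ * √(a ^ 2 - 2 * a * z + r ^ 2))) (Set.uIcc (-r) r) := by
      apply ContinuousOn.div (by fun_prop) (by fun_prop)
      intro z hz
      have hs : 0 < √(a ^ 2 - 2 * a * z + r ^ 2) := Real.sqrt_pos.2 (hpos z hz)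
      positivity
    refine this.congr ?_
    intro z hz
    have hs : 0 < √(a ^ 2 - 2 * a * z + r ^ 2) := Real.sqrt_pos.2 (hpos z hz)
    simp only [j0]
    rw [if_neg (by positivity)]
  rw [intervalIntegral.integral_eq_sub_of_hasDerivAt hd hc.intervalIntegrable]
  rw [show a ^ 2 - 2 * a * r + r ^ 2 = (a - r) ^ 2 by ring,
    show a ^ 2 - 2 * a * (-r) + r ^ 2 = (a + r) ^ 2 by ring, Real.sqrt_sq (by linarith),
    Real.sqrt_sq (by linarith), j0, j0, if_neg (by positivity), if_neg (by positivity),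
    mul_sub, mul_add, Real.cos_sub, Real.cos_add]
  field_simp
  ring

/-- The truncated density. -/
def trunc (R : ℝ) (ρ : ℝ → ℂ) (r : ℝ) : ℂ := if r < R then ρ r else 0

lemma trunc_meas (R : ℝ) (ρ : ℝ → ℂ) (h : Measurable ρ) : Measurable (trunc R ρ) := by
  unfold trunc
  exact Measurable.ite measurableSet_Iio h measurable_const

lemma trunc_int (R : ℝ) (ρ : ℝ → ℂ)
    (hρ_int : IntegrableOn (fun r : ℝ => ρ r * (r : ℂ) ^ 2) (Set.Icc 0 R)) :
    IntegrableOn (fun r : ℝ => (r : ℂ) ^ 2 * trunc R ρ r) (Set.Ioi 0) := by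
  have h := hρ_int.mono_set Set.Ioo_subset_Icc_self
  rw [← integrable_indicator_iff measurableSet_Ioo] at h
  rw [← integrable_indicator_iff measurableSet_Ioi]
  convert h using 1
  ext r
  by_cases h0 : 0 < r <;> by_cases h1 : r < R <;> simp [Set.indicator, trunc, h0, h1, mul_comm]

lemma swap_int (κ a R : ℝ) (ρ : ℝ → ℂ) (hρ_meas : Measurable ρ)
    (hρ_int : IntegrableOn (fun r : ℝ => ρ r * (r : ℂ) ^ 2) (Set.Icc 0 R)) :
    Integrable (Function.uncurry (fun z r : ℝ => if |z| < r then
      (r : ℂ) * (((j0 (κ * √(a ^ 2 - 2 * a * z + r ^ 2)) : ℝ) : ℂ) * trunc R ρ r) else 0))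
      (volume.prod volume) := by
  have hm : Measurable (Function.uncurry (fun z r : ℝ => if |z| < r then
      (r : ℂ) * (((j0 (κ * √(a ^ 2 - 2 * a * z + r ^ 2)) : ℝ) : ℂ) * trunc R ρ r) else 0)) := by
    unfold Function.uncurry
    refine Measurable.ite (measurableSet_lt (by fun_prop) (by fun_prop)) ?_ measurable_const
    have h1 : Measurable (fun p : ℝ × ℝ => j0 (κ * √(a ^ 2 - 2 * a * p.1 + p.2 ^ 2))) :=
      j0_meas.comp (by fun_prop)
    have h2 : Measurable (fun p : ℝ × ℝ => trunc R ρ p.2) :=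
      (trunc_meas R ρ hρ_meas).comp measurable_snd
    fun_prop
  have hb : ∀ z r : ℝ, ‖(if |z| < r then
      (r : ℂ) * (((j0 (κ * √(a ^ 2 - 2 * a * z + r ^ 2)) : ℝ) : ℂ) * trunc R ρ r) else 0)‖ ≤
      (Set.Ioo (-r) r).indicator (fun _ => |r| * ‖trunc R ρ r‖) z := by
    intro z r
    by_cases h : |z| < r
    · rw [if_pos h, Set.indicator_of_mem (by simpa [abs_lt] using h)]
      rw [norm_mul, norm_mul, Complex.norm_real, Complex.norm_real, Real.norm_eq_abs,
        Real.norm_eq_abs]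
      have := mul_le_mul_of_nonneg_right (j0_le (κ * √(a ^ 2 - 2 * a * z + r ^ 2)))
        (norm_nonneg (trunc R ρ r))
      rw [one_mul] at this
      gcongr
    · rw [if_neg h, norm_zero]
      exact Set.indicator_nonneg (fun _ _ => by positivity) _
  have hbi : ∀ r : ℝ, Integrable ((Set.Ioo (-r) r).indicator
      (fun _ : ℝ => |r| * ‖trunc R ρ r‖)) := by
    intro r
    rw [integrable_indicator_iff measurableSet_Ioo]
    exact integrableOn_const (by simp)
  rw [integrable_prod_iff' hm.aestronglyMeasurable]
  constructor
  · refine .of_forall fun r => ?_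
    exact (hbi r).mono' (hm.comp measurable_prodMk_right).aestronglyMeasurable
      (.of_forall fun z => hb z r)
  · have hI := ((integrable_indicator_iff measurableSet_Ioi).2 (trunc_int R ρ hρ_int)).norm.const_mul 2
    refine hI.mono' ?_ ?_
    · exact (hm.stronglyMeasurable.norm.integral_prod_left (μ := volume)).aestronglyMeasurable
    · refine .of_forall fun r => ?_
      rw [Real.norm_of_nonneg (integral_nonneg fun _ => norm_nonneg _)]
      refine (integral_mono_of_nonneg (.of_forall fun _ => norm_nonneg _) (hbi r)
        (.of_forall fun z => hb z r)).trans ?_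
      rw [integral_indicator_const _ measurableSet_Ioo]
      by_cases h0 : 0 < r
      · simp [Set.indicator, h0, Measure.real, abs_of_pos h0]
        rw [ENNReal.toReal_ofReal (by linarith)]
        apply le_of_eq; ring
      · have : Set.Ioo (-r) r = ∅ := Set.Ioo_eq_empty (by linarith)
        simp [this]

lemma inner_swap (κ a R r : ℝ) (hκ : 0 < κ) (hRa : R < a) (ρ : ℝ → ℂ) :
    (∫ z : ℝ, if |z| < r then
      (r : ℂ) * (((j0 (κ * √(a ^ 2 - 2 * a * z + r ^ 2)) : ℝ) : ℂ) * trunc R ρ r) else 0) =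
    (Set.Ioo 0 R).indicator (fun r : ℝ => (2 * ((j0 (κ * a) : ℝ) : ℂ)) *
      (ρ r * ((j0 (κ * r) : ℝ) : ℂ) * (r : ℂ) ^ 2)) r := by
  by_cases h0 : 0 < r
  · by_cases h1 : r < R
    · rw [Set.indicator_of_mem (Set.mem_Ioo.2 ⟨h0, h1⟩)]
      have : (fun z : ℝ => if |z| < r then
        (r : ℂ) * (((j0 (κ * √(a ^ 2 - 2 * a * z + r ^ 2)) : ℝ) : ℂ) * trunc R ρ r) else 0) =
        (Set.Ioo (-r) r).indicator (fun z : ℝ => ((j0 (κ * √(a ^ 2 - 2 * a * z + r ^ 2)) : ℝ) : ℂ)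
          * (r * ρ r)) := by
        ext z
        simp only [Set.indicator, Set.mem_Ioo, ← abs_lt, trunc, if_pos h1]
        congr 1
        ring
      rw [this, integral_indicator measurableSet_Ioo, ← integral_Ioc_eq_integral_Ioo,
        ← intervalIntegral.integral_of_le (by linarith), intervalIntegral.integral_mul_const,
        intervalIntegral.integral_ofReal, inner_int κ a r hκ h0 (h1.trans hRa)]
      push_cast
      ring
    · rw [Set.indicator_of_notMem (by simp [h1])]
      simp [trunc, h1]
  · rw [Set.indicator_of_notMem (by simp [h0])]
    have : ∀ z : ℝ, ¬ |z| < r := fun z hz => h0 ((abs_nonneg z).trans_lt hz)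
    simp [this]

theorem bessel_kernel_radial_density
    (κ R : ℝ) (hκ : 0 < κ) (hR : 0 < R)
    (ρ : ℝ → ℂ) (hρ_meas : Measurable ρ)
    (hρ_int : IntegrableOn (fun r : ℝ => ρ r * (r : ℂ) ^ 2) (Set.Icc 0 R)) :
    ∀ x : E3, R < ‖x‖ →
      (∫ y in ball3 R, ((j0 (κ * ‖x - y‖) : ℝ) : ℂ) * ρ ‖y‖) =
      ((4 * π : ℝ) : ℂ) * ((j0 (κ * ‖x‖) : ℝ) : ℂ) *
        ∫ r in (0 : ℝ)..R, ρ r * ((j0 (κ * r) : ℝ) : ℂ) * (r : ℂ) ^ 2 := by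
  intro x hx
  have hball : MeasurableSet (ball3 R) := measurableSet_lt measurable_norm measurable_const
  have e1 : (∫ y in ball3 R, ((j0 (κ * ‖x - y‖) : ℝ) : ℂ) * ρ ‖y‖) =
      ∫ y : E3, ((j0 (κ * ‖x - y‖) : ℝ) : ℂ) * trunc R ρ ‖y‖ := by
    rw [← integral_indicator hball]
    congr 1
    ext y
    by_cases h : ‖y‖ < R
    · rw [Set.indicator_of_mem (show y ∈ ball3 R from h), trunc, if_pos h]
    · rw [Set.indicator_of_notMem (show y ∉ ball3 R from h), trunc, if_neg h, mul_zero]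
  have hI : Integrable (fun y : E3 => trunc R ρ ‖y‖) := by
    rw [integrable_fun_norm_addHaar]
    simpa using trunc_int R ρ hρ_int
  have hint : Integrable (fun y : E3 => ((j0 (κ * ‖x - y‖) : ℝ) : ℂ) * trunc R ρ ‖y‖) := by
    refine hI.bdd_mul (c := 1) ?_ ?_
    · have : Measurable (fun y : E3 => j0 (κ * ‖x - y‖)) := j0_meas.comp (by fun_prop)
      exact (Complex.measurable_ofReal.comp this).aestronglyMeasurable
    · refine .of_forall fun y => ?_
      rw [Complex.norm_real]; exact j0_le _
  have e2 : ∀ z : ℝ, (∫ w : E2, ((j0 (κ * √((‖x‖ - z) ^ 2 + ‖w‖ ^ 2)) : ℝ) : ℂ) *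
      trunc R ρ (√(z ^ 2 + ‖w‖ ^ 2))) = (2 * π : ℝ) * ∫ r : ℝ, if |z| < r then
      (r : ℂ) * (((j0 (κ * √(‖x‖ ^ 2 - 2 * ‖x‖ * z + r ^ 2)) : ℝ) : ℂ) * trunc R ρ r) else 0 := by
    intro z
    rw [radial2 (fun s => ((j0 (κ * √((‖x‖ - z) ^ 2 + s ^ 2)) : ℝ) : ℂ) *
      trunc R ρ (√(z ^ 2 + s ^ 2)))]
    congr 1
    have := chvar z (fun r => ((j0 (κ * √(‖x‖ ^ 2 - 2 * ‖x‖ * z + r ^ 2)) : ℝ) : ℂ) * trunc R ρ r)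
    rw [← integral_indicator (measurableSet_Ioi (a := |z|))] at this
    refine Eq.trans ?_ this
    congr 1
    ext s
    rw [Real.sq_sqrt (by positivity),
      show ‖x‖ ^ 2 - 2 * ‖x‖ * z + (z ^ 2 + s ^ 2) = (‖x‖ - z) ^ 2 + s ^ 2 by ring]
  rw [e1, cyl x (fun u r => ((j0 (κ * u) : ℝ) : ℂ) * trunc R ρ r) hint]
  simp only [e2]
  rw [integral_const_mul, integral_integral_swap (swap_int κ ‖x‖ R ρ hρ_meas hρ_int)]
  simp only [inner_swap κ ‖x‖ R _ hκ hx ρ]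
  rw [integral_indicator measurableSet_Ioo, integral_const_mul,
    intervalIntegral.integral_of_le hR.le, integral_Ioc_eq_integral_Ioo]
  push_cast
  ring
end
end

section
/- Assume sin(κR) = 0 and let k ≥ 2 be an integer. With φ(r) = (j₀(κr))^k, the following orthogonality identity holds: ∫_0^R [ (d/dr)(r² φ′(r)) + κ² r² φ(r) ] j₀(κr) dr = 0. -/
open MeasureTheory Real

noncomputable section

theorem j0_eq_sinc : j0 = Real.sinc := rfl

/-- Derivative of `s ↦ j₀(κ s)` away from the origin. -/
theorem j0_hasDerivAt (κ r : ℝ) (hκ : 0 < κ) (hr : 0 < r) :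
    HasDerivAt (fun s : ℝ => j0 (κ * s))
      ((κ * r * Real.cos (κ * r) - Real.sin (κ * r)) / (κ * r ^ 2)) r := by
  have hl : HasDerivAt (fun s : ℝ => κ * s) κ r := by
    simpa using (hasDerivAt_id r).const_mul κ
  have h1 : HasDerivAt (fun s : ℝ => Real.sin (κ * s) / (κ * s))
      ((κ * r * Real.cos (κ * r) - Real.sin (κ * r)) / (κ * r ^ 2)) r := by
    have := hl.sin.div hl (by positivity)
    refine this.congr_deriv ?_
    field_simp
  refine h1.congr_of_eventuallyEq ?_
  filter_upwards [lt_mem_nhds hr] with s hs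
  have : κ * s ≠ 0 := by positivity
  simp [j0, this]

theorem g_hasDerivAt (κ r : ℝ) (hκ : 0 < κ) :
    HasDerivAt (fun s : ℝ => (κ * s * Real.cos (κ * s) - Real.sin (κ * s)) / κ)
      (-(κ * r * Real.sin (κ * r))) r := by
  have hl : HasDerivAt (fun s : ℝ => κ * s) κ r := by
    simpa using (hasDerivAt_id r).const_mul κ
  refine (((hl.mul hl.cos).sub hl.sin).div_const κ).congr_deriv ?_
  field_simp
  ring

theorem bessel_power_orthogonality
    (κ R : ℝ) (hκ : 0 < κ) (hR : 0 < R) (hRzero : Real.sin (κ * R) = 0)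
    (k : ℕ) (hk : 2 ≤ k) :
    (∫ r in (0 : ℝ)..R,
      (deriv (fun t : ℝ => t ^ 2 * deriv (fun s : ℝ => (j0 (κ * s)) ^ k) t) r
        + κ ^ 2 * r ^ 2 * (j0 (κ * r)) ^ k) * j0 (κ * r)) = 0 := by
  obtain ⟨n, rfl⟩ : ∃ n, k = n + 2 := ⟨k - 2, by omega⟩
  -- the Wronskian of the two functions is an antiderivative
  let W : ℝ → ℝ := fun r => ((n : ℝ) + 1) * ((j0 (κ * r)) ^ (n + 2) *
    ((κ * r * Real.cos (κ * r) - Real.sin (κ * r)) / κ))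
  have hj : Continuous j0 := by rw [j0_eq_sinc]; exact Real.continuous_sinc
  have hWc : Continuous W := by
    have : Continuous fun r : ℝ => j0 (κ * r) := hj.comp (by fun_prop)
    fun_prop
  have hW0 : W 0 = 0 := by simp [W]
  have hWR : W R = 0 := by
    simp [W, j0, hRzero, hκ.ne', hR.ne']
  have hd : ∀ r ∈ Set.Ioo 0 R, HasDerivAt W
      ((deriv (fun t : ℝ => t ^ 2 * deriv (fun s : ℝ => (j0 (κ * s)) ^ (n + 2)) t) r
        + κ ^ 2 * r ^ 2 * (j0 (κ * r)) ^ (n + 2)) * j0 (κ * r)) r := by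
    intro r hr
    have hr0 : 0 < r := hr.1
    have hu := j0_hasDerivAt κ r hκ hr0
    have hg := g_hasDerivAt κ r hκ
    have hs : Real.sin (κ * r) = κ * r * j0 (κ * r) := by
      have : κ * r ≠ 0 := by positivity
      simp only [j0, this, if_false]
      field_simp
    have hF := (((hu.fun_pow (n + 1)).fun_mul hg).const_mul ((n : ℝ) + 2)).congr_of_eventuallyEq
        (f₁ := fun t : ℝ => t ^ 2 * deriv (fun s : ℝ => (j0 (κ * s)) ^ (n + 2)) t) (by
      filter_upwards [lt_mem_nhds hr0] with t ht
      have := ((j0_hasDerivAt κ t hκ ht).fun_pow (n + 2)).deriv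
      rw [this]
      simp
      field_simp)
    rw [hF.deriv]
    refine (((hu.fun_pow (n + 2)).fun_mul hg).const_mul ((n : ℝ) + 1)).congr_deriv ?_
    simp only [hs]
    push_cast
    field_simp
    ring
  by_cases hint : IntervalIntegrable (fun r =>
      (deriv (fun t : ℝ => t ^ 2 * deriv (fun s : ℝ => (j0 (κ * s)) ^ (n + 2)) t) r
        + κ ^ 2 * r ^ 2 * (j0 (κ * r)) ^ (n + 2)) * j0 (κ * r)) volume 0 R
  · rw [intervalIntegral.integral_eq_sub_of_hasDerivAt_of_le hR.le hWc.continuousOn hd hint,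
      hW0, hWR, sub_zero]
  · exact intervalIntegral.integral_undef hint
end
end

section
/- Assume sin(κR) = 0 and let k ≥ 2 be an integer. With φ(r) = (j₀(κr))^k and ĵ₀(r) = sinh(κr)/(κr) (ĵ₀(0) = 1), the following identity holds: ∫_0^R [ (d/dr)(r² φ′(r)) + κ² r² φ(r) ] ĵ₀(r) dr = 2κ² ∫_0^R φ(r) ĵ₀(r) r² dr. -/
open MeasureTheory Real

noncomputable section

/-- The modified spherical Bessel function of order zero, with frequency `κ`. -/
def jh0 (κ r : ℝ) : ℝ := if r = 0 then 1 else Real.sinh (κ * r) / (κ * r)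

theorem analytic_dslope_zero (f : ℝ → ℝ) (hf : ∀ x, AnalyticAt ℝ f x) (x : ℝ) :
    AnalyticAt ℝ (dslope f 0) x := by
  by_cases hx : x = 0
  · subst hx
    obtain ⟨p, hp⟩ := hf 0
    exact ⟨_, hp.has_fpower_series_dslope_fslope⟩
  · refine AnalyticAt.congr ?_ (dslope_eventuallyEq_slope_of_ne f hx).symm
    have : slope f 0 = fun y => y⁻¹ * (f y - f 0) := by
      funext y
      simp [slope]
    rw [this]
    exact (analyticAt_id.inv hx).mul ((hf x).sub analyticAt_const)

theorem j0_contDiff : ContDiff ℝ 2 j0 := by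
  have h : j0 = dslope Real.sin 0 := by
    rw [← Real.sinc_eq_dslope]; rfl
  rw [h, contDiff_iff_contDiffAt]
  exact fun x => (analytic_dslope_zero _ (fun y => Real.analyticAt_sin) x).contDiffAt

theorem jh0_contDiff (κ : ℝ) (hκ : 0 < κ) : ContDiff ℝ 2 (jh0 κ) := by
  have hd : HasDerivAt (fun r => Real.sinh (κ * r) / κ) 1 0 := by
    have h1 : HasDerivAt (fun r : ℝ => κ * r) κ 0 := by
      simpa using (hasDerivAt_id (0:ℝ)).const_mul κ
    have := (h1.sinh).div_const κ
    simpa [hκ.ne'] using this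
  have h : jh0 κ = dslope (fun r => Real.sinh (κ * r) / κ) 0 := by
    funext r
    by_cases hr : r = 0
    · subst hr
      simp [jh0, hd.deriv]
    · rw [dslope_of_ne _ hr]
      simp [jh0, hr, slope]
      field_simp
  rw [h, contDiff_iff_contDiffAt]
  refine fun x => (analytic_dslope_zero _ (fun y => ?_) x).contDiffAt
  have h1 : AnalyticAt ℝ (fun r : ℝ => κ * r) y := analyticAt_const.mul analyticAt_id
  exact (AnalyticAt.comp (g := Real.sinh) Real.analyticAt_sinh h1).div analyticAt_const hκ.ne'

theorem jh0_ode (κ : ℝ) (hκ : 0 < κ) (r : ℝ) :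
    2 * r * deriv (jh0 κ) r + r ^ 2 * deriv (deriv (jh0 κ)) r = κ ^ 2 * r ^ 2 * jh0 κ r := by
  have hg := jh0_contDiff κ hκ
  have hg1 : ∀ x, HasDerivAt (jh0 κ) (deriv (jh0 κ) x) x := fun x =>
    ((hg.differentiable (by norm_num)) x).hasDerivAt
  have hg2 : ∀ x, HasDerivAt (deriv (jh0 κ)) (deriv (deriv (jh0 κ)) x) x := fun x =>
    (((contDiff_succ_iff_deriv (n := 1)).1 hg).2.2.differentiable (by norm_num) x).hasDerivAt
  have e0 : ∀ x, x * jh0 κ x = Real.sinh (κ * x) / κ := by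
    intro x
    by_cases hx : x = 0
    · simp [hx]
    · simp [jh0, hx]; field_simp
  have hm : ∀ x : ℝ, HasDerivAt (fun r : ℝ => κ * r) κ x := fun x => by
    simpa using (hasDerivAt_id x).const_mul κ
  have e1 : ∀ x, jh0 κ x + x * deriv (jh0 κ) x = Real.cosh (κ * x) := by
    intro x
    have h1 := (hasDerivAt_id x).mul (hg1 x)
    have h2 := ((hm x).sinh).div_const κ
    have h3 : (id * jh0 κ) = fun x => Real.sinh (κ * x) / κ := funext e0
    rw [h3] at h1
    have := h1.unique h2
    simp only [id, one_mul] at this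
    rw [this]; field_simp
  have e2 : deriv (jh0 κ) r + (deriv (jh0 κ) r + r * deriv (deriv (jh0 κ)) r)
      = Real.sinh (κ * r) * κ := by
    have h1 := (hg1 r).add ((hasDerivAt_id r).mul (hg2 r))
    have h3 : (jh0 κ + id * deriv (jh0 κ)) = fun x => Real.cosh (κ * x) := funext e1
    rw [h3] at h1
    have := h1.unique (hm r).cosh
    simpa only [id, one_mul] using this
  have e3 : Real.sinh (κ * r) = κ * (r * jh0 κ r) := by
    rw [e0]; field_simp
  rw [e3] at e2
  linear_combination r * e2

theorem bessel_core (κ R : ℝ) (φ g : ℝ → ℝ) (hφ : ContDiff ℝ 2 φ) (hg : ContDiff ℝ 2 g)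
    (ode : ∀ r, 2 * r * deriv g r + r ^ 2 * deriv (deriv g) r = κ ^ 2 * r ^ 2 * g r)
    (hφR : φ R = 0) (hφR' : deriv φ R = 0) :
    (∫ r in (0 : ℝ)..R,
      (deriv (fun t : ℝ => t ^ 2 * deriv φ t) r + κ ^ 2 * r ^ 2 * φ r) * g r) =
      2 * κ ^ 2 * ∫ r in (0 : ℝ)..R, φ r * g r * r ^ 2 := by
  have hg1 : ∀ x, HasDerivAt g (deriv g x) x := fun x =>
    ((hg.differentiable (by norm_num)) x).hasDerivAt
  have hgc := ((contDiff_succ_iff_deriv (n := 1)).1 hg).2.2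
  have hg2 : ∀ x, HasDerivAt (deriv g) (deriv (deriv g) x) x := fun x =>
    (hgc.differentiable (by norm_num) x).hasDerivAt
  have hφ1 : ∀ x, HasDerivAt φ (deriv φ x) x := fun x =>
    ((hφ.differentiable (by norm_num)) x).hasDerivAt
  have hφc := ((contDiff_succ_iff_deriv (n := 1)).1 hφ).2.2
  have hφ2 : ∀ x, HasDerivAt (deriv φ) (deriv (deriv φ) x) x := fun x =>
    (hφc.differentiable (by norm_num) x).hasDerivAt
  have hφcc : Continuous (deriv (deriv φ)) := hφc.continuous_deriv (by norm_num)
  have cφ := hφ.continuous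
  have cφ' := hφc.continuous
  have cg := hg.continuous
  have hsq : ∀ x : ℝ, HasDerivAt (fun t : ℝ => t ^ 2) (2 * x) x := fun x => by
    simpa using hasDerivAt_pow 2 x
  have hA : ∀ r, HasDerivAt (fun t : ℝ => t ^ 2 * deriv φ t)
      (2 * r * deriv φ r + r ^ 2 * deriv (deriv φ) r) r := fun r => (hsq r).mul (hφ2 r)
  have hB : ∀ r, HasDerivAt (fun t : ℝ => t ^ 2 * deriv g t)
      (κ ^ 2 * r ^ 2 * g r) r := fun r => by
    rw [← ode r]; exact (hsq r).mul (hg2 r)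
  simp only [fun r => (hA r).deriv]
  have hF : ∀ r, HasDerivAt (fun t : ℝ => t ^ 2 * deriv φ t * g t - φ t * (t ^ 2 * deriv g t))
      ((2 * r * deriv φ r + r ^ 2 * deriv (deriv φ) r + κ ^ 2 * r ^ 2 * φ r) * g r
        - 2 * κ ^ 2 * (φ r * g r * r ^ 2)) r := fun r => by
    refine HasDerivAt.congr_deriv (((hA r).mul (hg1 r)).sub ((hφ1 r).mul (hB r))) ?_
    ring
  have hI := intervalIntegral.integral_eq_sub_of_hasDerivAt (a := 0) (b := R)
    (fun r _ => hF r) (Continuous.intervalIntegrable (by fun_prop) _ _)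
  rw [intervalIntegral.integral_sub (Continuous.intervalIntegrable (by fun_prop) _ _)
    (Continuous.intervalIntegrable (by fun_prop) _ _),
    intervalIntegral.integral_const_mul] at hI
  rw [hφR', hφR] at hI
  simp only [mul_zero, zero_mul, ne_eq, OfNat.ofNat_ne_zero, not_false_eq_true, zero_pow,
    sub_zero] at hI
  linarith

theorem bessel_power_modified_identity
    (κ R : ℝ) (hκ : 0 < κ) (hR : 0 < R) (hRzero : Real.sin (κ * R) = 0)
    (k : ℕ) (hk : 2 ≤ k) :
    (∫ r in (0 : ℝ)..R,
      (deriv (fun t : ℝ => t ^ 2 * deriv (fun s : ℝ => (j0 (κ * s)) ^ k) t) r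
        + κ ^ 2 * r ^ 2 * (j0 (κ * r)) ^ k) * jh0 κ r) =
      2 * κ ^ 2 * ∫ r in (0 : ℝ)..R, (j0 (κ * r)) ^ k * jh0 κ r * r ^ 2 := by
  have hu : ContDiff ℝ 2 (fun s : ℝ => j0 (κ * s)) :=
    j0_contDiff.comp (contDiff_const.mul contDiff_id)
  have huR : j0 (κ * R) = 0 := by
    have : κ * R ≠ 0 := by positivity
    simp [j0, this, hRzero]
  have hφ : ContDiff ℝ 2 (fun s : ℝ => (j0 (κ * s)) ^ k) := hu.pow k
  have hφR' : deriv (fun s : ℝ => (j0 (κ * s)) ^ k) R = 0 := by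
    have h := ((hu.differentiable (by norm_num)) R).hasDerivAt.pow k
    have h2 := h.deriv
    have hk1 : k - 1 ≠ 0 := by omega
    simp only [huR, zero_pow hk1, mul_zero, zero_mul] at h2
    exact h2
  have hφR : (fun s : ℝ => (j0 (κ * s)) ^ k) R = 0 := by
    simp only [huR]; exact zero_pow (by omega)
  exact bessel_core κ R _ _ hφ (jh0_contDiff κ hκ) (jh0_ode κ hκ) hφR hφR'
end
end
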